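/- arXiv:2407.14652 — 2 statements merged into one kernel-verified Lean document; each statement's English description precedes it below -/
import Mathlib

section
/- Let n ≥ 1, let T = C_r ⊗ … ⊗ C₁ with C_i ∈ B(ϖ_{ℓ_i}) and 1 ≤ ℓ₁ ≤ … ≤ ℓ_r ≤ n, let μ ∈ ℤⁿ be dominant with nonnegative entries such that T ⊗ T⁰_μ is semistandard, and let j ∈ [n−1] with j ∉ C₁ and j+1 ∈ C₁. Then: if j ∈ C_r and j+1 ∉ C_r, Ψ_{T⊗T⁰_μ} = T_j Ψ_{Ω^j_r(T)⊗T⁰_μ} + Σ σ^j_{C_k} (1−t) Ψ_{Ω^j_k(T)⊗T⁰_μ}, the sum over k with 1 ≤ k < r and σ^j_{C_k} σ^j_{C_{k+1}} = −1; otherwise Ψ_{T⊗T⁰_μ} = tT_j⁻¹ Ψ_{Ω^j_r(T)⊗T⁰_μ} + Σ σ^j_{C_k} (1−t) Ψ_{Ω^j_k(T)⊗T⁰_μ} over the same index set. Here Ω^j_k(T) = C_r ⊗ … ⊗ C_{k+1} ⊗ s_jC_k ⊗ … ⊗ s_jC₁, and σ^j_C = −1 if j ∈ C and j+1 ∉ C,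 and σ^j_C = +1 otherwise. -/
set_option maxHeartbeats 1000000

attribute [local instance] Classical.propDecidable

noncomputable section

namespace HLHecke

/-- The base ring `ℤ[t^{±1}]` of Laurent polynomials. -/
abbrev HR : Type := LaurentPolynomial ℤ

/-- The parameter `t`. -/
def tt : HR := LaurentPolynomial.T 1

/-! ### The symmetric group on `Fin n` -/

/-- The simple transposition `s_j = (j, j+1)` (junk value `1` if out of range). -/
def sgen (n : ℕ) (j : ℕ) : Equiv.Perm (Fin n) :=
  if h : j + 1 < n then Equiv.swap ⟨j, Nat.lt_of_succ_lt h⟩ ⟨j + 1, h⟩ else 1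

/-- The product `s_{i₁} ⋯ s_{i_ℓ}` of a word `l = [i₁, …, i_ℓ]`. -/
def wordProd (n : ℕ) (l : List ℕ) : Equiv.Perm (Fin n) := (l.map (sgen n)).prod

/-- The action of `S_n` on `ℤⁿ` by permutation of coordinates. -/
def wAct (n : ℕ) (w : Equiv.Perm (Fin n)) (μ : Fin n → ℤ) : Fin n → ℤ := fun i => μ (w⁻¹ i)

/-- The standard inner product on `ℤⁿ`. -/
def ip (n : ℕ) (μ ν : Fin n → ℤ) : ℤ := ∑ i, μ i * ν i

/-- The standard basis vector `ε_i`. -/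
def eps (n : ℕ) (i : Fin n) : Fin n → ℤ := fun k => if k = i then 1 else 0

/-- The simple root `α_j = ε_j − ε_{j+1}` (0-indexed: entries `j` and `j+1` of `Fin n`). -/
def alpha (n : ℕ) (j : ℕ) : Fin n → ℤ :=
  fun i => if (i : ℕ) = j then 1 else if (i : ℕ) = j + 1 then -1 else 0

/-- The fundamental weight `ϖ_k = ε₁ + … + ε_k`. -/
def varpi (n : ℕ) (k : ℕ) : Fin n → ℤ := fun i => if (i : ℕ) < k then 1 else 0

/-- The set of positive roots `R₊`. -/
def Rpos (n : ℕ) (β : Fin n → ℤ) : Prop := ∃ i j : Fin n, i < j ∧ β = eps n i - eps n j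

/-- The Coxeter length: minimal length of a word in the simple transpositions. -/
def len (n : ℕ) (w : Equiv.Perm (Fin n)) : ℕ :=
  sInf {k | ∃ l : List ℕ, (∀ j ∈ l, j + 1 < n) ∧ l.length = k ∧ wordProd n l = w}

/-- A choice of reduced word for `w`. -/
def redWord (n : ℕ) (w : Equiv.Perm (Fin n)) : List ℕ :=
  if h : ∃ l : List ℕ, (∀ j ∈ l, j + 1 < n) ∧ l.length = len n w ∧ wordProd n l = w
  then h.choose else []

/-! ### Columns -/

lemma col_card_le (n : ℕ) (C : Finset (Fin n)) : C.card ≤ n := by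
  simpa using Finset.card_le_univ C

/-- The minimal length coset representative `u_C` attached to a column `C`:
it sends `1, …, ℓ` to the entries of `C` in increasing order and `ℓ+1, …, n` to the
entries of the complement of `C` in increasing order. -/
def colPerm (n : ℕ) (C : Finset (Fin n)) : Equiv.Perm (Fin n) :=
  ((finCongr ((Nat.add_sub_cancel' (col_card_le n C)).symm)).trans
    finSumFinEquiv.symm).trans <|
  ((Equiv.sumCongr (C.orderIsoOfFin rfl).toEquiv
      ((Cᶜ.orderIsoOfFin (by simp [Finset.card_compl])).toEquiv)).trans <|
    (Equiv.sumCongr (Equiv.refl _) (Equiv.subtypeEquivRight (fun x => Finset.mem_compl))).trans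
      (Equiv.sumCompl (fun x => x ∈ C)))

/-- The `k`-th smallest entry of a column (0-indexed, as a natural number; junk `0` if
out of range). -/
def nth (n : ℕ) (C : Finset (Fin n)) (k : ℕ) : ℕ := ((C.sort (· ≤ ·)).map Fin.val).getD k 0

/-- The action of the simple transposition `s_j` on columns. -/
def sCol (n : ℕ) (j : ℕ) (C : Finset (Fin n)) : Finset (Fin n) := C.image (sgen n j)

/-- Semistandardness of the two-column filling `F ⊗ E` (`F` the left column):
entrywise `f_i ≤ e_i`. -/
def pairSS (n : ℕ) (F E : Finset (Fin n)) : Prop := ∀ k < E.card, nth n F k ≤ nth n E k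

/-- A filling by columns (leftmost column first) is semistandard iff all adjacent pairs are. -/
def isSSYT (n : ℕ) (L : List (Finset (Fin n))) : Prop := L.Chain' (pairSS n)

/-- The set `B(ϖ_ℓ)` of columns of length `ℓ`. -/
def colFinset (n : ℕ) (ℓ : ℕ) : Finset (Finset (Fin n)) := Finset.univ.filter fun C => C.card = ℓ

/-- The highest weight column `(1, …, k)`. -/
def hwCol (n : ℕ) (k : ℕ) : Finset (Fin n) := Finset.univ.filter fun x => (x : ℕ) < k

/-- The vector `⃗C ∈ ℤⁿ` attached to a column `C`. -/
def vecOf (n : ℕ) (C : Finset (Fin n)) : Fin n → ℤ := fun i => if i ∈ C then 1 else 0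

/-- The sign `σ^j_C`: `-1` if `j ∈ C` and `j+1 ∉ C`, and `+1` otherwise. -/
def sigmaSign (n : ℕ) (j : ℕ) (C : Finset (Fin n)) : ℤ :=
  if h : j + 1 < n then
    (if (⟨j, Nat.lt_of_succ_lt h⟩ : Fin n) ∈ C ∧ (⟨j + 1, h⟩ : Fin n) ∉ C then -1 else 1)
  else 1

/-! ### Shapes and tableaux -/

/-- The length `λ'_{j+1}` of the `(j+1)`-st column (0-indexed `j`) of the Young diagram
of a partition `λ`. -/
def shapeColLen (n : ℕ) (μ : Fin n → ℤ) (j : ℕ) : ℕ :=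
  (Finset.univ.filter fun i : Fin n => (j : ℤ) < μ i).card

/-- The number of columns of the Young diagram of a dominant weight. -/
def numCols (n : ℕ) (μ : Fin n → ℤ) : ℕ := Finset.univ.sup fun i : Fin n => (μ i).toNat

/-- The highest weight tableau `T⁰_μ`: row `i` is filled with `i`, i.e. its columns are the
highest weight columns. -/
def hwTableau (n : ℕ) (μ : Fin n → ℤ) : List (Finset (Fin n)) :=
  List.ofFn fun j : Fin (numCols n μ) => hwCol n (shapeColLen n μ (j : ℕ))

/-- The content vector of a tableau: `(wtVec T) i` is the number of entries equal to `i`. -/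
def wtVec (n : ℕ) (L : List (Finset (Fin n))) : Fin n → ℤ :=
  fun i => ((L.filter fun C => i ∈ C).length : ℤ)

/-! ### Macdonald's ψ statistic -/

/-- Number of entries `≤ i` in the column at position `p` (0-indexed from the left). -/
def colCount (n : ℕ) (L : List (Finset (Fin n))) (i p : ℕ) : ℕ :=
  ((L.getD p ∅).filter fun x => (x : ℕ) < i).card

/-- The factor `ψ_{T_{≤ i+1}/T_{≤ i}}` of Macdonald's ψ. -/
def stripFactor (n : ℕ) (L : List (Finset (Fin n))) (i : ℕ) : HR :=
  ∏ p ∈ Finset.range L.length,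
    if colCount n L (i + 1) p = colCount n L i p ∧
        colCount n L (i + 1) (p + 1) = colCount n L i (p + 1) + 1 then
      1 - tt ^ (colCount n L i p - colCount n L i (p + 1))
    else 1

/-- Macdonald's `ψ_T = ∏_{i=1}^{n-1} ψ_{T_{≤ i+1}/T_{≤ i}}` for a semistandard tableau. -/
def macPsi (n : ℕ) (L : List (Finset (Fin n))) : HR := ∏ i ∈ Finset.Ico 1 n, stripFactor n L i

/-- Macdonald's tableau statistic, extended by `0` to non-semistandard fillings. -/
def psiT (n : ℕ) (L : List (Finset (Fin n))) : HR := if isSSYT n L then macPsi n L else 0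

/-! ### The affine Hecke algebra -/

/-- Generators of the affine Hecke algebra. -/
inductive AGen (n : ℕ) : Type
  | T : ℕ → AGen n
  | X : Fin n → AGen n
  | Xinv : Fin n → AGen n

/-- The free algebra on the generators. -/
abbrev FA (n : ℕ) := FreeAlgebra HR (AGen n)

def fT (n : ℕ) (j : ℕ) : FA n := FreeAlgebra.ι HR (AGen.T j)
def fX (n : ℕ) (i : Fin n) : FA n := FreeAlgebra.ι HR (AGen.X i)
def fXi (n : ℕ) (i : Fin n) : FA n := FreeAlgebra.ι HR (AGen.Xinv i)

/-- The defining relations of the type `GL_n` affine Hecke algebra. -/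
inductive ARel (n : ℕ) : FA n → FA n → Prop
  | junk (j : ℕ) (h : ¬ j + 1 < n) : ARel n (fT n j) 1
  | quad (j : ℕ) (h : j + 1 < n) :
      ARel n (fT n j * fT n j) ((tt - 1) • fT n j + algebraMap HR (FA n) tt)
  | braid (j : ℕ) (h : j + 2 < n) :
      ARel n (fT n j * fT n (j + 1) * fT n j) (fT n (j + 1) * fT n j * fT n (j + 1))
  | commT (j k : ℕ) (hjk : j + 1 < k) (hk : k + 1 < n) :
      ARel n (fT n j * fT n k) (fT n k * fT n j)
  | commX (i i' : Fin n) : ARel n (fX n i * fX n i') (fX n i' * fX n i)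
  | XinvL (i : Fin n) : ARel n (fX n i * fXi n i) 1
  | XinvR (i : Fin n) : ARel n (fXi n i * fX n i) 1
  | TXT (j : ℕ) (h : j + 1 < n) :
      ARel n (fT n j * fX n ⟨j, Nat.lt_of_succ_lt h⟩ * fT n j) (tt • fX n ⟨j + 1, h⟩)
  | TXcomm (j : ℕ) (h : j + 1 < n) (i : Fin n) (hi1 : (i : ℕ) ≠ j) (hi2 : (i : ℕ) ≠ j + 1) :
      ARel n (fT n j * fX n i) (fX n i * fT n j)

/-- The type `GL_n` affine Hecke algebra. -/
abbrev H (n : ℕ) := RingQuot (ARel n)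

/-- The generator `T_j` of the (affine) Hecke algebra. -/
def Tg (n : ℕ) (j : ℕ) : H n := RingQuot.mkAlgHom HR (ARel n) (fT n j)

/-- The generator `X_i`. -/
def Xg (n : ℕ) (i : Fin n) : H n := RingQuot.mkAlgHom HR (ARel n) (fX n i)

/-- The generator `X_i⁻¹`. -/
def Xig (n : ℕ) (i : Fin n) : H n := RingQuot.mkAlgHom HR (ARel n) (fXi n i)

/-- The scalar `t` inside `H`. -/
def tH (n : ℕ) : H n := algebraMap HR (H n) tt

/-- The scalar `t^k` inside `H`. -/
def tpow (n : ℕ) (k : ℕ) : H n := algebraMap HR (H n) (tt ^ k)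

/-- The monomial `X^μ` for `μ ∈ ℤⁿ`. -/
def Xmon (n : ℕ) (μ : Fin n → ℤ) : H n :=
  (List.ofFn fun i : Fin n =>
    if 0 ≤ μ i then Xg n i ^ (μ i).toNat else Xig n i ^ (-μ i).toNat).prod

/-- The product `T_{i₁} ⋯ T_{i_ℓ}` of a word. -/
def TofWord (n : ℕ) (l : List ℕ) : H n := (l.map (Tg n)).prod

/-- The element `T_w`, defined via a choice of reduced word for `w`. -/
def Tw (n : ℕ) (w : Equiv.Perm (Fin n)) : H n := TofWord n (redWord n w)

/-- The finite Hecke symmetrizer `1₀ = Σ_{w ∈ S_n} T_w`. -/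
def one0 (n : ℕ) : H n := ∑ w : Equiv.Perm (Fin n), Tw n w

/-- The stabilizer `S_{n,λ}` as a finset. -/
def stabFinset (n : ℕ) (lam : Fin n → ℤ) : Finset (Equiv.Perm (Fin n)) :=
  Finset.univ.filter fun w => wAct n w lam = lam

/-- The parabolic symmetrizer `1_λ = Σ_{w ∈ S_{n,λ}} T_w`. -/
def onePara (n : ℕ) (lam : Fin n → ℤ) : H n := ∑ w ∈ stabFinset n lam, Tw n w

/-- The Poincaré polynomial `W_λ(t) = Σ_{w ∈ S_{n,λ}} t^{ℓ(w)}`. -/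
def Wlam (n : ℕ) (lam : Fin n → ℤ) : HR := ∑ w ∈ stabFinset n lam, tt ^ len n w

/-- The parabolic subalgebra `H_{n,λ}`, as the span of `{T_w : w ∈ S_{n,λ}}`. -/
def HparaM (n : ℕ) (lam : Fin n → ℤ) : Submodule HR (H n) :=
  Submodule.span HR (Tw n '' {w | wAct n w lam = lam})

/-- The finite Hecke algebra `H_n`, the subalgebra generated by the `T_j`. -/
def Hfin (n : ℕ) : Subalgebra HR (H n) := Algebra.adjoin HR (Set.range (Tg n))

/-- The coefficient `h_{C, S}` of the parabolic decomposition
`h = Σ_{F ∈ B(ϖ_ℓ)} T_{u_F} h_F` (defined via choice; it is unique). -/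
def paraCoeff (n : ℕ) (ℓ : ℕ) (h : H n) (C : Finset (Fin n)) : H n :=
  if hex : ∃ g : Finset (Fin n) → H n,
      (∀ F : Finset (Fin n), F.card = ℓ → g F ∈ HparaM n (varpi n ℓ)) ∧
      h = ∑ F ∈ colFinset n ℓ, Tw n (colPerm n F) * g F
  then hex.choose C else 0

/-- The elements `Ψ_T` of the finite Hecke algebra, defined by recursion on the columns of `T`
(leftmost column first).  By convention `Ψ` of the empty tableau is `1₀`. -/
def Psi (n : ℕ) : List (Finset (Fin n)) → H n
  | [] => one0 n
  | [C] => tpow n (len n (colPerm n C)) * Ring.inverse (Tw n (colPerm n C)⁻¹) *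
      onePara n (varpi n C.card)
  | C :: S => tpow n (len n (colPerm n C)) * Ring.inverse (Tw n (colPerm n C)⁻¹) *
      paraCoeff n C.card (Psi n S) C

end HLHecke
namespace HLHecke

/-- The tableau `Ω^j_m(T) ⊗ T⁰_μ` where `T = C_r ⊗ … ⊗ C₁` is encoded by
`Cc : ℕ → Finset (Fin n)` with `Cc (k-1) = C_k` (so index `0` is the rightmost column),
and `s_j` has been applied to the rightmost `m` columns.  For `m = 0` this is `T ⊗ T⁰_μ`
itself and for `m = r` it is `Ω^j_r(T) ⊗ T⁰_μ`. -/
def OmTab (n : ℕ) (j r : ℕ) (Cc : ℕ → Finset (Fin n)) (μ : Fin n → ℤ) (m : ℕ) :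
    List (Finset (Fin n)) :=
  (List.ofFn fun k : Fin r => if (k : ℕ) < m then sCol n j (Cc k) else Cc k).reverse
    ++ hwTableau n μ

def asc (n j : ℕ) (hj : j + 1 < n) (w : Equiv.Perm (Fin n)) : Prop :=
  w⁻¹ ⟨j, Nat.lt_of_succ_lt hj⟩ < w⁻¹ ⟨j + 1, hj⟩

lemma sgen_eq {n j : ℕ} (hj : j + 1 < n) :
    sgen n j = Equiv.swap ⟨j, Nat.lt_of_succ_lt hj⟩ ⟨j + 1, hj⟩ := by
  simp [sgen, hj]

lemma sgen_sq (n j : ℕ) : sgen n j * sgen n j = 1 := by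
  unfold sgen; split <;> simp

lemma sgen_inv (n j : ℕ) : (sgen n j)⁻¹ = sgen n j := by
  rw [inv_eq_iff_mul_eq_one, sgen_sq]

lemma sgen_sgen (n j : ℕ) (w : Equiv.Perm (Fin n)) : sgen n j * (sgen n j * w) = w := by
  rw [← mul_assoc, sgen_sq, one_mul]

lemma sgen_app_app (n j : ℕ) (x : Fin n) : sgen n j (sgen n j x) = x := by
  rw [← Equiv.Perm.mul_apply, sgen_sq]; rfl

lemma sgen_val {n j : ℕ} (hj : j + 1 < n) (x : Fin n) :
    ((sgen n j x : Fin n) : ℕ) = if (x : ℕ) = j then j + 1 else if (x : ℕ) = j + 1 then j else x := by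
  rw [sgen_eq hj, Equiv.swap_apply_def]
  simp only [Fin.ext_iff]
  split_ifs <;> rfl

lemma sgen_j {n j : ℕ} (hj : j + 1 < n) :
    sgen n j ⟨j, Nat.lt_of_succ_lt hj⟩ = ⟨j + 1, hj⟩ := by
  apply Fin.ext; rw [sgen_val hj]; simp

lemma sgen_j1 {n j : ℕ} (hj : j + 1 < n) :
    sgen n j ⟨j + 1, hj⟩ = ⟨j, Nat.lt_of_succ_lt hj⟩ := by
  apply Fin.ext; rw [sgen_val hj]; simp

lemma sgen_ne {n j : ℕ} (hj : j + 1 < n) (x : Fin n) (h1 : (x : ℕ) ≠ j) (h2 : (x : ℕ) ≠ j + 1) :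
    sgen n j x = x := by
  apply Fin.ext; rw [sgen_val hj]; simp [h1, h2]

lemma sgen_mul_inv_apply (n j : ℕ) (w : Equiv.Perm (Fin n)) (x : Fin n) :
    (sgen n j * w)⁻¹ x = w⁻¹ (sgen n j x) := by
  rw [mul_inv_rev, sgen_inv]; rfl

lemma asc_sgen {n j : ℕ} (hj : j + 1 < n) (w : Equiv.Perm (Fin n)) :
    asc n j hj (sgen n j * w) ↔ ¬ asc n j hj w := by
  unfold asc
  rw [sgen_mul_inv_apply, sgen_mul_inv_apply, sgen_j hj, sgen_j1 hj, not_lt]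
  have : w⁻¹ ⟨j + 1, hj⟩ ≠ w⁻¹ ⟨j, Nat.lt_of_succ_lt hj⟩ := by
    intro h; have := w⁻¹.injective h; simp at this
  exact ⟨le_of_lt, fun h => lt_of_le_of_ne h this⟩

def invs (n : ℕ) (w : Equiv.Perm (Fin n)) : Finset (Fin n × Fin n) :=
  Finset.univ.filter fun p => p.1 < p.2 ∧ w⁻¹ p.2 < w⁻¹ p.1

lemma sgen_lt {n j : ℕ} (hj : j + 1 < n) {a b : Fin n} (hab : a < b)
    (h : ¬ ((a : ℕ) = j ∧ (b : ℕ) = j + 1)) : sgen n j a < sgen n j b := by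
  rw [Fin.lt_def] at *
  rw [sgen_val hj, sgen_val hj]
  split_ifs <;> omega

lemma invs_asc {n j : ℕ} (hj : j + 1 < n) (w : Equiv.Perm (Fin n)) (h : asc n j hj w) :
    (invs n (sgen n j * w)).card = (invs n w).card + 1 := by
  have : invs n (sgen n j * w) =
      insert (⟨j, Nat.lt_of_succ_lt hj⟩, ⟨j + 1, hj⟩)
        ((invs n w).map ((Equiv.prodCongr (sgen n j) (sgen n j)).toEmbedding)) := by
    ext ⟨a, b⟩
    simp only [invs, Finset.mem_filter, Finset.mem_univ, true_and, Finset.mem_insert,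
      Finset.mem_map_equiv, Prod.mk.injEq, sgen_mul_inv_apply]
    have hsymm : (Equiv.prodCongr (sgen n j) (sgen n j)).symm (a, b) = (sgen n j a, sgen n j b) := by
      rw [Equiv.symm_apply_eq]; simp [sgen_app_app]
    rw [hsymm]
    by_cases hab : a = ⟨j, Nat.lt_of_succ_lt hj⟩ ∧ b = ⟨j + 1, hj⟩
    · obtain ⟨rfl, rfl⟩ := hab
      simp only [sgen_j hj, sgen_j1 hj, and_self, true_or, iff_true]
      exact ⟨Fin.mk_lt_mk.2 (Nat.lt_succ_self j), h⟩
    · simp only [hab, false_or]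
      constructor
      · rintro ⟨h1, h2⟩
        exact ⟨sgen_lt hj h1 (by simpa [Fin.ext_iff] using hab), h2⟩
      · rintro ⟨h1, h2⟩
        refine ⟨?_, h2⟩
        have := sgen_lt hj h1 ?_
        · simpa [sgen_app_app] using this
        · rintro ⟨h3, h4⟩
          have e3 : sgen n j a = ⟨j, Nat.lt_of_succ_lt hj⟩ := Fin.ext h3
          have e4 : sgen n j b = ⟨j + 1, hj⟩ := Fin.ext h4
          rw [e3, e4] at h2
          exact absurd h (not_lt.mpr h2.le)
  rw [this, Finset.card_insert_of_notMem, Finset.card_map]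
  simp only [invs, Finset.mem_map_equiv, Finset.mem_filter, Finset.mem_univ, true_and]
  have hsymm : (Equiv.prodCongr (sgen n j) (sgen n j)).symm
      ((⟨j, Nat.lt_of_succ_lt hj⟩, ⟨j + 1, hj⟩) : Fin n × Fin n) =
      (⟨j + 1, hj⟩, ⟨j, Nat.lt_of_succ_lt hj⟩) := by
    rw [Equiv.symm_apply_eq]; simp [sgen_j hj, sgen_j1 hj]
  rw [hsymm]
  rintro ⟨h1, -⟩
  have h1 := Fin.mk_lt_mk.1 h1
  omega

lemma invs_desc {n j : ℕ} (hj : j + 1 < n) (w : Equiv.Perm (Fin n)) (h : ¬ asc n j hj w) :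
    (invs n w).card = (invs n (sgen n j * w)).card + 1 := by
  have := invs_asc hj (sgen n j * w) ((asc_sgen hj w).2 h)
  rwa [sgen_sgen] at this

lemma perm_eq_one_of_mono {n : ℕ} (w : Equiv.Perm (Fin n)) (h : StrictMono w) : w = 1 := by
  have h2 : (OrderIso.refl (Fin n)) = h.orderIsoOfSurjective w w.surjective := Subsingleton.elim _ _
  ext x
  have := congrArg (fun e => (e x : Fin n)) h2
  simpa using (congrArg Fin.val this).symm

lemma exists_desc {n : ℕ} (w : Equiv.Perm (Fin n)) (h : w ≠ 1) :
    ∃ j, ∃ hj : j + 1 < n, ¬ asc n j hj w := by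
  by_contra hc
  push Not at hc
  apply h
  have : w⁻¹ = 1 := by
    apply perm_eq_one_of_mono
    cases n with
    | zero => intro a; exact a.elim0
    | succ m =>
      rw [Fin.strictMono_iff_lt_succ]
      intro i
      exact hc i (by omega)
  simpa using this

lemma invs_one (n : ℕ) : (invs n 1).card = 0 := by
  simp only [invs, Finset.card_eq_zero, Finset.filter_eq_empty_iff]
  rintro ⟨a, b⟩ _ ⟨h1, h2⟩
  simp at h1 h2
  exact absurd h1 (not_lt.mpr h2.le)

lemma wordProd_cons (n i : ℕ) (l : List ℕ) : wordProd n (i :: l) = sgen n i * wordProd n l := by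
  simp [wordProd]

lemma invs_word_le (n : ℕ) (l : List ℕ) (hl : ∀ j ∈ l, j + 1 < n) :
    (invs n (wordProd n l)).card ≤ l.length := by
  induction l with
  | nil => simp [wordProd, invs_one]
  | cons i l ih =>
    have := ih (fun j hj => hl j (List.mem_cons_of_mem _ hj))
    rw [wordProd_cons]
    have hi := hl i List.mem_cons_self
    by_cases h : asc n i hi (wordProd n l)
    · rw [invs_asc hi _ h]; simp; omega
    · have := invs_desc hi _ h
      simp; omega

lemma exists_word (n : ℕ) : ∀ (N : ℕ) (w : Equiv.Perm (Fin n)), (invs n w).card = N →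
    ∃ l : List ℕ, (∀ j ∈ l, j + 1 < n) ∧ l.length = N ∧ wordProd n l = w := by
  intro N
  induction N with
  | zero =>
    intro w hw
    by_cases h1 : w = 1
    · exact ⟨[], by simp, rfl, by simp [wordProd, h1]⟩
    · obtain ⟨j, hj, h⟩ := exists_desc w h1
      have := invs_desc hj w h
      omega
  | succ N ih =>
    intro w hw
    by_cases h1 : w = 1
    · rw [h1, invs_one] at hw; omega
    · obtain ⟨j, hj, h⟩ := exists_desc w h1
      have := invs_desc hj w h
      obtain ⟨l, h1, h2, h3⟩ := ih (sgen n j * w) (by omega)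
      refine ⟨j :: l, ?_, by simp [h2], by rw [wordProd_cons, h3, sgen_sgen]⟩
      intro k hk
      rcases List.mem_cons.1 hk with rfl | hk
      · exact hj
      · exact h1 k hk

lemma len_eq (n : ℕ) (w : Equiv.Perm (Fin n)) : len n w = (invs n w).card := by
  apply le_antisymm
  · exact Nat.sInf_le (exists_word n _ w rfl)
  · apply le_csInf
    · exact ⟨_, exists_word n _ w rfl⟩
    · rintro k ⟨l, h1, h2, rfl⟩
      rw [← h2]; exact invs_word_le n l h1

lemma redWord_spec (n : ℕ) (w : Equiv.Perm (Fin n)) :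
    (∀ j ∈ redWord n w, j + 1 < n) ∧ (redWord n w).length = len n w ∧
      wordProd n (redWord n w) = w := by
  have h : ∃ l : List ℕ, (∀ j ∈ l, j + 1 < n) ∧ l.length = len n w ∧ wordProd n l = w := by
    rw [len_eq]; exact exists_word n _ w rfl
  rw [redWord, dif_pos h]
  exact h.choose_spec

lemma len_inv (n : ℕ) (w : Equiv.Perm (Fin n)) : len n w⁻¹ = len n w := by
  have key : ∀ w : Equiv.Perm (Fin n), len n w⁻¹ ≤ len n w := by
    intro w
    obtain ⟨h1, h2, h3⟩ := redWord_spec n w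
    refine Nat.sInf_le ⟨(redWord n w).reverse, by simpa using h1, by simpa using h2, ?_⟩
    conv_rhs => rw [← h3]
    unfold wordProd
    rw [List.prod_inv_reverse, List.map_reverse, List.map_map]
    congr 2
    apply List.map_congr_left
    intro a _
    simp [sgen_inv]
  exact le_antisymm (key w) (by simpa using key w⁻¹)

/-! Hecke relations -/
lemma Tg_quad {n j : ℕ} (hj : j + 1 < n) :
    Tg n j * Tg n j = (tt - 1) • Tg n j + algebraMap HR (H n) tt := by
  have := RingQuot.mkAlgHom_rel HR (ARel.quad (n := n) j hj)
  simpa [Tg] using this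

lemma Tg_braid {n j : ℕ} (hj : j + 2 < n) :
    Tg n j * Tg n (j + 1) * Tg n j = Tg n (j + 1) * Tg n j * Tg n (j + 1) := by
  have := RingQuot.mkAlgHom_rel HR (ARel.braid (n := n) j hj)
  simpa [Tg] using this

lemma Tg_comm {n j k : ℕ} (hjk : j + 1 < k) (hk : k + 1 < n) :
    Tg n j * Tg n k = Tg n k * Tg n j := by
  have := RingQuot.mkAlgHom_rel HR (ARel.commT (n := n) j k hjk hk)
  simpa [Tg] using this

def Red (n : ℕ) (l : List ℕ) (w : Equiv.Perm (Fin n)) : Prop :=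
  (∀ j ∈ l, j + 1 < n) ∧ l.length = (invs n w).card ∧ wordProd n l = w

lemma Red.exists' (n : ℕ) (w : Equiv.Perm (Fin n)) : ∃ l, Red n l w := exists_word n _ w rfl

lemma Red.cons {n j : ℕ} (hj : j + 1 < n) {l : List ℕ} {w : Equiv.Perm (Fin n)}
    (h : Red n l w) (ha : asc n j hj w) : Red n (j :: l) (sgen n j * w) := by
  obtain ⟨h1, h2, h3⟩ := h
  refine ⟨?_, ?_, ?_⟩
  · intro k hk
    rcases List.mem_cons.1 hk with rfl | hk
    · exact hj
    · exact h1 k hk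
  · rw [invs_asc hj w ha, ← h2]; rfl
  · rw [wordProd_cons, h3]

lemma Red.uncons {n j : ℕ} {l : List ℕ} {w : Equiv.Perm (Fin n)}
    (h : Red n (j :: l) w) : ∃ hj : j + 1 < n, Red n l (sgen n j * w) ∧ ¬ asc n j hj w := by
  obtain ⟨h1, h2, h3⟩ := h
  have hj := h1 j List.mem_cons_self
  have hl : ∀ k ∈ l, k + 1 < n := fun k hk => h1 k (List.mem_cons_of_mem _ hk)
  have h4 : wordProd n l = sgen n j * w := by rw [← h3, wordProd_cons, sgen_sgen]
  have h5 := invs_word_le n l hl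
  rw [h4] at h5
  have h6 : ¬ asc n j hj w := by
    intro ha
    have := invs_asc hj w ha
    simp at h2
    omega
  have := invs_desc hj w h6
  simp at h2
  exact ⟨hj, ⟨hl, by omega, h4⟩, h6⟩

lemma sgen_comm {n i k : ℕ} (hik : i + 1 < k) (hk : k + 1 < n) :
    sgen n i * sgen n k = sgen n k * sgen n i := by
  have hi : i + 1 < n := by omega
  ext x
  simp only [Equiv.Perm.mul_apply, sgen_val hi, sgen_val hk]
  split_ifs <;> omega

lemma sgen_braid {n i : ℕ} (hk : i + 2 < n) :
    sgen n i * (sgen n (i + 1) * sgen n i) = sgen n (i + 1) * (sgen n i * sgen n (i + 1)) := by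
  have hi : i + 1 < n := by omega
  have hk' : i + 1 + 1 < n := hk
  ext x
  simp only [Equiv.Perm.mul_apply, sgen_val hi, sgen_val hk']
  split_ifs <;> omega

lemma asc_sgen_far {n i k : ℕ} (hi : i + 1 < n) (hk : k + 1 < n)
    (h : i + 1 < k ∨ k + 1 < i) (w : Equiv.Perm (Fin n)) :
    asc n i hi (sgen n k * w) ↔ asc n i hi w := by
  unfold asc
  rw [sgen_mul_inv_apply, sgen_mul_inv_apply, sgen_ne hk, sgen_ne hk] <;> simp <;> omega

lemma asc_near1 {n i : ℕ} (hk : i + 1 + 1 < n) (w : Equiv.Perm (Fin n)) :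
    asc n i (by omega) (sgen n (i + 1) * w) ↔
      w⁻¹ ⟨i, by omega⟩ < w⁻¹ ⟨i + 1 + 1, hk⟩ := by
  unfold asc
  rw [sgen_mul_inv_apply, sgen_mul_inv_apply, sgen_ne hk, sgen_j hk] <;> simp <;> omega

lemma asc_near2 {n i : ℕ} (hk : i + 1 + 1 < n) (w : Equiv.Perm (Fin n)) :
    asc n (i + 1) hk (sgen n i * w) ↔
      w⁻¹ ⟨i, by omega⟩ < w⁻¹ ⟨i + 1 + 1, hk⟩ := by
  unfold asc
  have hi : i + 1 < n := by omega
  rw [sgen_mul_inv_apply, sgen_mul_inv_apply, sgen_j1 hi, sgen_ne hi] <;> simp <;> omega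

lemma asc_near3 {n i : ℕ} (hk : i + 1 + 1 < n) (w : Equiv.Perm (Fin n)) :
    asc n i (by omega) (sgen n (i + 1) * (sgen n i * w)) ↔ asc n (i + 1) hk w := by
  rw [asc_near1 hk]
  have hi : i + 1 < n := by omega
  rw [sgen_mul_inv_apply, sgen_mul_inv_apply, sgen_j hi, sgen_ne hi] <;> simp [asc]
  omega

lemma asc_near4 {n i : ℕ} (hk : i + 1 + 1 < n) (w : Equiv.Perm (Fin n)) :
    asc n (i + 1) hk (sgen n i * (sgen n (i + 1) * w)) ↔ asc n i (by omega) w := by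
  rw [asc_near2 hk]
  rw [sgen_mul_inv_apply, sgen_mul_inv_apply, sgen_j1 hk, sgen_ne hk] <;> simp [asc]
  omega

lemma TofWord_cons (n i : ℕ) (l : List ℕ) : TofWord n (i :: l) = Tg n i * TofWord n l := by
  simp [TofWord]

lemma not_asc_iff {n j : ℕ} (hj : j + 1 < n) (w : Equiv.Perm (Fin n)) :
    ¬ asc n j hj w ↔ w⁻¹ ⟨j + 1, hj⟩ < w⁻¹ ⟨j, Nat.lt_of_succ_lt hj⟩ := by
  rw [← asc_sgen]
  unfold asc
  rw [sgen_mul_inv_apply, sgen_mul_inv_apply, sgen_j hj, sgen_j1 hj]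

lemma matsumoto (n : ℕ) : ∀ (N : ℕ) (w : Equiv.Perm (Fin n)), (invs n w).card = N →
    ∀ l l', Red n l w → Red n l' w → TofWord n l = TofWord n l' := by
  intro N
  induction N with
  | zero =>
    intro w hw l l' h h'
    have h1 := h.2.1
    have h1' := h'.2.1
    rw [hw, List.length_eq_zero_iff] at h1 h1'
    rw [h1, h1']
  | succ N ih =>
    intro w hw
    -- far case
    have far : ∀ i k a b, i + 1 < k → Red n (i :: a) w → Red n (k :: b) w →
        TofWord n (i :: a) = TofWord n (k :: b) := by
      intro i k a b hik ha hb
      obtain ⟨hi, ra, di⟩ := ha.uncons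
      obtain ⟨hk, rb, dk⟩ := hb.uncons
      obtain ⟨c, rc⟩ := Red.exists' n (sgen n k * (sgen n i * w))
      have e : sgen n k * (sgen n i * w) = sgen n i * (sgen n k * w) := by
        rw [← mul_assoc, ← mul_assoc, sgen_comm hik hk]
      have r1 : Red n (k :: c) (sgen n i * w) := by
        have := rc.cons hk (by
          rw [asc_sgen, asc_sgen_far hk hi (by omega)]; exact dk)
        rwa [sgen_sgen] at this
      have r2 : Red n (i :: c) (sgen n k * w) := by
        rw [e] at rc
        have := rc.cons hi (by
          rw [asc_sgen, asc_sgen_far hi hk (by omega)]; exact di)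
        rwa [sgen_sgen] at this
      have i1 := invs_desc hi w di
      have i2 := invs_desc hk w dk
      rw [TofWord_cons, TofWord_cons, ih _ (by omega) _ _ ra r1, ih _ (by omega) _ _ rb r2,
        TofWord_cons, TofWord_cons, ← mul_assoc, ← mul_assoc, Tg_comm hik hk]
    have near : ∀ i a b, Red n (i :: a) w → Red n ((i + 1) :: b) w →
        TofWord n (i :: a) = TofWord n ((i + 1) :: b) := by
      intro i a b ha hb
      obtain ⟨hi, ra, di⟩ := ha.uncons
      obtain ⟨hk, rb, dk⟩ := hb.uncons
      have di' := (not_asc_iff hi w).1 di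
      have dk' := (not_asc_iff hk w).1 dk
      obtain ⟨c, rc⟩ := Red.exists' n (sgen n i * (sgen n (i + 1) * (sgen n i * w)))
      have e : sgen n i * (sgen n (i + 1) * (sgen n i * w)) =
          sgen n (i + 1) * (sgen n i * (sgen n (i + 1) * w)) := by
        have := congrArg (· * w) (sgen_braid (n := n) (i := i) hk)
        simpa [mul_assoc] using this
      have hne : ¬ w⁻¹ ⟨i, by omega⟩ < w⁻¹ ⟨i + 1 + 1, hk⟩ :=
        not_lt.mpr (dk'.trans di').le
      have r1 : Red n ((i + 1) :: i :: c) (sgen n i * w) := by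
        have := rc.cons hi (by rw [asc_sgen, asc_near3 hk]; exact dk)
        rw [sgen_sgen] at this
        have := this.cons hk (by rw [asc_sgen, asc_near2 hk]; exact hne)
        rwa [sgen_sgen] at this
      have r2 : Red n (i :: (i + 1) :: c) (sgen n (i + 1) * w) := by
        rw [e] at rc
        have := rc.cons hk (by rw [asc_sgen, asc_near4 hk]; exact di)
        rw [sgen_sgen] at this
        have := this.cons hi (by rw [asc_sgen, asc_near1 hk]; exact hne)
        rwa [sgen_sgen] at this
      have i1 := invs_desc hi w di
      have i2 := invs_desc hk w dk
      have := congrArg (· * TofWord n c) (Tg_braid (n := n) (j := i) hk)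
      rw [TofWord_cons, TofWord_cons, ih _ (by omega) _ _ ra r1, ih _ (by omega) _ _ rb r2]
      simp only [TofWord_cons]
      simpa only [mul_assoc] using this
    intro l l' h h'
    cases l with
    | nil => have := h.2.1; simp at this; omega
    | cons i a =>
      cases l' with
      | nil => have := h'.2.1; simp at this; omega
      | cons k b =>
        rcases lt_trichotomy i k with hik | rfl | hik
        · by_cases h2 : k = i + 1
          · subst h2; exact near i a b h h'
          · exact far i k a b (by omega) h h'
        · obtain ⟨hi, ra, di⟩ := h.uncons
          obtain ⟨_, rb, _⟩ := h'.uncons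
          have i1 := invs_desc hi w di
          rw [TofWord_cons, TofWord_cons, ih _ (by omega) _ _ ra rb]
        · by_cases h2 : i = k + 1
          · subst h2; exact (near k b a h' h).symm
          · exact (far k i b a (by omega) h' h).symm

lemma redWord_Red (n : ℕ) (w : Equiv.Perm (Fin n)) : Red n (redWord n w) w := by
  have := redWord_spec n w
  rwa [len_eq] at this

lemma Tw_of_Red {n : ℕ} {w : Equiv.Perm (Fin n)} {l : List ℕ} (h : Red n l w) :
    Tw n w = TofWord n l := matsumoto n _ w rfl _ _ (redWord_Red n w) h

lemma Tw_one (n : ℕ) : Tw n 1 = 1 := by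
  rw [Tw_of_Red (l := []) ⟨by simp, by simp [invs_one], by simp [wordProd]⟩]
  simp [TofWord]

lemma Tw_asc {n j : ℕ} (hj : j + 1 < n) {w : Equiv.Perm (Fin n)} (h : asc n j hj w) :
    Tw n (sgen n j * w) = Tg n j * Tw n w := by
  rw [Tw_of_Red ((redWord_Red n w).cons hj h), TofWord_cons]; rfl

lemma Tw_desc {n j : ℕ} (hj : j + 1 < n) {w : Equiv.Perm (Fin n)} (h : ¬ asc n j hj w) :
    Tw n w = Tg n j * Tw n (sgen n j * w) := by
  have := Tw_asc hj ((asc_sgen hj w).2 h)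
  rwa [sgen_sgen] at this

lemma Tg_mul_Tw {n j : ℕ} (hj : j + 1 < n) (w : Equiv.Perm (Fin n)) :
    Tg n j * Tw n w = if asc n j hj w then Tw n (sgen n j * w)
      else tt • Tw n (sgen n j * w) + (tt - 1) • Tw n w := by
  split_ifs with h
  · rw [Tw_asc hj h]
  · conv_lhs => rw [Tw_desc hj h]
    conv_rhs => rw [Tw_desc hj h]
    rw [← mul_assoc, Tg_quad hj, add_mul, add_comm, smul_mul_assoc, ← Algebra.smul_def]

lemma Tw_right {n j : ℕ} (hj : j + 1 < n) {w : Equiv.Perm (Fin n)} (h : asc n j hj w⁻¹) :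
    Tw n (w * sgen n j) = Tw n w * Tg n j := by
  have hr := redWord_Red n w
  have : Red n (redWord n w ++ [j]) (w * sgen n j) := by
    refine ⟨?_, ?_, ?_⟩
    · intro k hk
      rcases List.mem_append.1 hk with hk | hk
      · exact hr.1 k hk
      · simp at hk; subst hk; exact hj
    · rw [← len_eq, ← len_inv, len_eq, mul_inv_rev, sgen_inv, invs_asc hj _ h, ← len_eq, len_inv,
        len_eq, ← hr.2.1]; simp
    · have := hr.2.2
      simp only [wordProd, List.map_append, List.prod_append] at this ⊢
      rw [this]; simp
  rw [Tw_of_Red this]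
  simp [TofWord, Tw]

lemma tt_unit : IsUnit tt := by
  refine IsUnit.of_mul_eq_one (LaurentPolynomial.T (-1)) ?_
  rw [tt, ← LaurentPolynomial.T_add]; simp

def Tt (n j : ℕ) : H n := Tg n j + (1 - tt) • (1 : H n)

lemma tH_comm (n : ℕ) (x : H n) : tH n * x = x * tH n := Algebra.commutes _ _

lemma tH_smul (n : ℕ) (x : H n) : tH n * x = tt • x := by rw [Algebra.smul_def]; rfl

lemma tH_eq (n : ℕ) : tH n = tt • (1 : H n) := by rw [← tH_smul, mul_one]

lemma one_sub_tH_mul (n : ℕ) (x : H n) : (1 - tH n) * x = (1 - tt) • x := by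
  have h : (1 - tH n) = (1 - tt) • (1 : H n) := by
    rw [tH_eq]
    have e : (1 : H n) - tt • (1 : H n) + tt • (1 : H n) = 1 :=
      sub_add_cancel (1 : H n) (tt • (1 : H n))
    generalize (1 : H n) - tt • (1 : H n) = y at e
    calc y = (y + tt • (1 : H n)) + (-tt) • (1 : H n) := by module
      _ = _ := by rw [e]; module
  rw [h, smul_mul_assoc, one_mul]

lemma Tt_mul (n j : ℕ) (x : H n) : Tt n j * x = Tg n j * x + (1 - tt) • x := by
  rw [Tt, add_mul, smul_mul_assoc, one_mul]

lemma Tg_Tt {n j : ℕ} (hj : j + 1 < n) : Tg n j * Tt n j = tH n := by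
  rw [Tt, mul_add, Tg_quad hj, mul_smul_comm, mul_one, tH_eq, Algebra.algebraMap_eq_smul_one]
  module

lemma Tt_Tg {n j : ℕ} (hj : j + 1 < n) : Tt n j * Tg n j = tH n := by
  rw [← Tg_Tt hj, Tt, mul_add, add_mul, mul_smul_comm, smul_mul_assoc, mul_one, one_mul]

lemma tH_unit (n : ℕ) : IsUnit (tH n) := tt_unit.map (algebraMap HR (H n))

lemma Tg_unit {n j : ℕ} (hj : j + 1 < n) : IsUnit (Tg n j) := by
  obtain ⟨u, hu⟩ := tH_unit n
  have hc : ∀ x : H n, (↑u⁻¹ : H n) * x = x * ↑u⁻¹ := by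
    intro x
    have : Commute (u : H n) x := by rw [hu]; exact tH_comm n x
    exact this.units_inv_left
  refine ⟨⟨Tg n j, ↑u⁻¹ * Tt n j, ?_, ?_⟩, rfl⟩
  · rw [hc, ← mul_assoc, Tg_Tt hj, ← hu, Units.mul_inv]
  · rw [mul_assoc, Tt_Tg hj, ← hu, Units.inv_mul]

lemma tH_inv_Tg {n j : ℕ} (hj : j + 1 < n) : tH n * Ring.inverse (Tg n j) = Tt n j := by
  rw [← Tt_Tg hj, mul_assoc, Ring.mul_inverse_cancel _ (Tg_unit hj), mul_one]

lemma TofWord_unit (n : ℕ) (l : List ℕ) (hl : ∀ j ∈ l, j + 1 < n) : IsUnit (TofWord n l) := by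
  induction l with
  | nil => simp [TofWord]
  | cons i l ih =>
    rw [TofWord_cons]
    exact (Tg_unit (hl i List.mem_cons_self)).mul (ih fun j hj => hl j (List.mem_cons_of_mem _ hj))

lemma Tw_unit (n : ℕ) (w : Equiv.Perm (Fin n)) : IsUnit (Tw n w) :=
  TofWord_unit n _ (redWord_Red n w).1

lemma ring_inverse_mul {n : ℕ} {a b : H n} (ha : IsUnit a) (hb : IsUnit b) :
    Ring.inverse (a * b) = Ring.inverse b * Ring.inverse a := by
  obtain ⟨a, rfl⟩ := ha
  obtain ⟨b, rfl⟩ := hb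
  rw [← Units.val_mul, Ring.inverse_unit, Ring.inverse_unit, Ring.inverse_unit, mul_inv_rev,
    Units.val_mul]

/-- span of the T_w -/
def MM (n : ℕ) : Submodule HR (H n) := Submodule.span HR (Set.range (Tw n))

lemma Tw_mem (n : ℕ) (w : Equiv.Perm (Fin n)) : Tw n w ∈ MM n := Submodule.subset_span ⟨w, rfl⟩

lemma Tg_mul_mem {n j : ℕ} (hj : j + 1 < n) {x : H n} (hx : x ∈ MM n) : Tg n j * x ∈ MM n := by
  induction hx using Submodule.span_induction with
  | mem x h =>
    obtain ⟨w, rfl⟩ := h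
    rw [Tg_mul_Tw hj]
    split_ifs
    · exact Tw_mem _ _
    · exact Submodule.add_mem _ (Submodule.smul_mem _ _ (Tw_mem _ _))
        (Submodule.smul_mem _ _ (Tw_mem _ _))
  | zero => simp
  | add x y _ _ h1 h2 => rw [mul_add]; exact Submodule.add_mem _ h1 h2
  | smul a x _ h => rw [mul_smul_comm]; exact Submodule.smul_mem _ _ h

lemma Tt_mul_mem {n j : ℕ} (hj : j + 1 < n) {x : H n} (hx : x ∈ MM n) : Tt n j * x ∈ MM n := by
  rw [Tt_mul]
  exact Submodule.add_mem _ (Tg_mul_mem hj hx) (Submodule.smul_mem _ _ hx)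

lemma inv_Tg_mul_mem {n j : ℕ} (hj : j + 1 < n) {x : H n} (hx : x ∈ MM n) :
    Ring.inverse (Tg n j) * x ∈ MM n := by
  have h := Tt_mul_mem hj hx
  rw [← tH_inv_Tg hj, mul_assoc, tH_smul] at h
  obtain ⟨u, hu⟩ := tt_unit
  have := Submodule.smul_mem _ (↑u⁻¹ : HR) h
  rwa [smul_smul, ← hu, Units.inv_mul, one_smul] at this

lemma inv_TofWord_mul_mem (n : ℕ) (l : List ℕ) (hl : ∀ j ∈ l, j + 1 < n) :
    ∀ x ∈ MM n, Ring.inverse (TofWord n l) * x ∈ MM n := by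
  induction l with
  | nil => intro x hx; simpa [TofWord] using hx
  | cons i l ih =>
    intro x hx
    have h2 : ∀ j ∈ l, j + 1 < n := fun j hj => hl j (List.mem_cons_of_mem _ hj)
    have hi := hl i List.mem_cons_self
    rw [TofWord_cons, ring_inverse_mul (Tg_unit hi) (TofWord_unit n l h2), mul_assoc]
    exact ih h2 _ (inv_Tg_mul_mem hi hx)

section JM
variable {G : Type*} [Group G]

def JMx (g : ℕ → G) (z : G) : ℕ → G
  | 0 => 1
  | k + 1 => z⁻¹ * (g k * JMx g z k * g k)

lemma JMx_comm1 (n : ℕ) (g : ℕ → G) (z : G) (hz : ∀ x : G, Commute z x)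
    (hc : ∀ i k, i + 1 < k → k + 1 < n → Commute (g i) (g k)) (k : ℕ) :
    ∀ j, k < j → j + 1 < n → Commute (g j) (JMx g z k) := by
  induction k with
  | zero => intro j _ _; exact Commute.one_right _
  | succ k ih =>
    intro j hj hn
    have h1 := (hc k j (by omega) hn).symm
    exact ((hz _).symm.inv_right).mul_right ((h1.mul_right (ih j (by omega) hn)).mul_right h1)

lemma JMx_comm2 (n : ℕ) (g : ℕ → G) (z : G) (hz : ∀ x : G, Commute z x)
    (hc : ∀ i k, i + 1 < k → k + 1 < n → Commute (g i) (g k))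
    (hb : ∀ i, i + 2 < n → g i * g (i + 1) * g i = g (i + 1) * g i * g (i + 1)) (k : ℕ) :
    ∀ j, j + 1 < k → k < n → Commute (g j) (JMx g z k) := by
  induction k with
  | zero => intro j h _; omega
  | succ k ih =>
    intro j hj hn
    by_cases h : j + 1 < k
    · have h1 := hc j k h hn
      exact ((hz _).symm.inv_right).mul_right
        ((h1.mul_right (ih j (by omega) (by omega))).mul_right h1)
    · have : k = j + 1 := by omega
      subst this
      have hx := JMx_comm1 n g z hz hc j (j + 1) (by omega) (by omega)
      have hbr := hb j (by omega)
      have hzi : ∀ x : G, Commute x z⁻¹ := fun x => (hz x).symm.inv_right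
      refine (hzi _).mul_right ?_
      have e : g (j + 1) * JMx g z (j + 1) * g (j + 1)
          = z⁻¹ * ((g (j + 1) * g j) * JMx g z j * (g j * g (j + 1))) := by
        simp only [JMx]
        rw [← mul_assoc (g (j + 1)) z⁻¹, (hzi _).eq]
        simp only [mul_assoc]
      rw [e]
      refine (hzi _).mul_right ?_
      unfold Commute SemiconjBy
      calc g j * (g (j + 1) * g j * JMx g z j * (g j * g (j + 1)))
          = (g j * g (j + 1) * g j) * JMx g z j * (g j * g (j + 1)) := by simp only [mul_assoc]
        _ = g (j + 1) * g j * (g (j + 1) * JMx g z j) * (g j * g (j + 1)) := by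
            rw [hbr]; simp only [mul_assoc]
        _ = g (j + 1) * g j * JMx g z j * (g (j + 1) * g j * g (j + 1)) := by
            rw [hx.eq]; simp only [mul_assoc]
        _ = _ := by rw [← hbr]; simp only [mul_assoc]

lemma JMx_comm3 (n : ℕ) (g : ℕ → G) (z : G) (hz : ∀ x : G, Commute z x)
    (hc : ∀ i k, i + 1 < k → k + 1 < n → Commute (g i) (g k))
    (hb : ∀ i, i + 2 < n → g i * g (i + 1) * g i = g (i + 1) * g i * g (i + 1)) (k' : ℕ)
    (hk' : k' < n) (k : ℕ) :
    k < k' → Commute (JMx g z k) (JMx g z k') := by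
  induction k with
  | zero => intro _; exact Commute.one_left _
  | succ k ih =>
    intro h
    have h1 := JMx_comm2 n g z hz hc hb k' k h hk'
    exact ((hz _).inv_left).mul_left ((h1.mul_left (ih (by omega))).mul_left h1)
end JM

abbrev RA (n : ℕ) := Module.End HR (Equiv.Perm (Fin n) → HR)

def rop (n j : ℕ) (hj : j + 1 < n) : RA n where
  toFun f := fun w => if asc n j hj w then tt * f (sgen n j * w)
    else f (sgen n j * w) + (tt - 1) * f w
  map_add' f g := by
    funext w; simp only [Pi.add_apply]; split_ifs <;> ring
  map_smul' c f := by
    funext w; simp only [Pi.smul_apply, smul_eq_mul, RingHom.id_apply]; split_ifs <;> ring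

lemma rop_apply {n j : ℕ} (hj : j + 1 < n) (f : Equiv.Perm (Fin n) → HR) (w) :
    rop n j hj f w = if asc n j hj w then tt * f (sgen n j * w)
    else f (sgen n j * w) + (tt - 1) * f w := rfl

lemma rop_quad {n j : ℕ} (hj : j + 1 < n) :
    rop n j hj * rop n j hj = (tt - 1) • rop n j hj + algebraMap HR (RA n) tt := by
  apply LinearMap.ext; intro f; funext w
  rw [Algebra.algebraMap_eq_smul_one]
  simp only [Module.End.mul_apply, LinearMap.add_apply, LinearMap.smul_apply, Pi.add_apply,
    Pi.smul_apply, Module.End.one_apply, smul_eq_mul, rop_apply, asc_sgen, sgen_sgen]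
  by_cases h : asc n j hj w <;> simp only [h, if_true, if_false, not_true, not_false_eq_true] <;> ring

lemma rop_comm {n i k : ℕ} (hi : i + 1 < n) (hik : i + 1 < k) (hk : k + 1 < n) :
    rop n i hi * rop n k hk = rop n k hk * rop n i hi := by
  apply LinearMap.ext; intro f; funext w
  have e : sgen n k * (sgen n i * w) = sgen n i * (sgen n k * w) := by
    rw [← mul_assoc, ← mul_assoc, sgen_comm hik hk]
  simp only [Module.End.mul_apply, rop_apply, asc_sgen_far hi hk (Or.inl hik),
    asc_sgen_far hk hi (Or.inr hik), e]
  split_ifs <;> ring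

lemma rop_braid {n i : ℕ} (hk : i + 1 + 1 < n) :
    rop n i (by omega) * rop n (i + 1) hk * rop n i (by omega) =
    rop n (i + 1) hk * rop n i (by omega) * rop n (i + 1) hk := by
  apply LinearMap.ext; intro f; funext w
  have hi : i + 1 < n := by omega
  have e : sgen n i * (sgen n (i + 1) * (sgen n i * w)) =
      sgen n (i + 1) * (sgen n i * (sgen n (i + 1) * w)) := by
    have := congrArg (· * w) (sgen_braid (n := n) (i := i) hk)
    simpa [mul_assoc] using this
  simp only [Module.End.mul_apply, rop_apply, asc_near3 hk,
    asc_near4 hk, asc_sgen, sgen_sgen, e]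
  simp only [asc_near1 hk, asc_near2 hk]
  have e1 : asc n i hi w ↔ w⁻¹ ⟨i, by omega⟩ < w⁻¹ ⟨i + 1, hi⟩ := Iff.rfl
  have e2 : asc n (i + 1) hk w ↔ w⁻¹ ⟨i + 1, hi⟩ < w⁻¹ ⟨i + 1 + 1, hk⟩ := Iff.rfl
  have n1 := not_asc_iff hi w
  have n2 := not_asc_iff hk w
  by_cases h1 : asc n i hi w <;> by_cases h2 : asc n (i + 1) hk w <;>
    by_cases h3 : w⁻¹ ⟨i, by omega⟩ < w⁻¹ ⟨i + 1 + 1, hk⟩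
  · simp only [h1, h2, h3, if_true, if_false, not_true]
  · exact absurd ((e1.1 h1).trans (e2.1 h2)) h3
  · simp only [h1, h2, h3, if_true, if_false, not_true, not_false_eq_true]; ring
  · simp only [h1, h2, h3, if_true, if_false, not_true, not_false_eq_true]; ring
  · simp only [h1, h2, h3, if_true, if_false, not_true, not_false_eq_true]; ring
  · simp only [h1, h2, h3, if_true, if_false, not_true, not_false_eq_true]; ring
  · exact absurd h3 (not_lt.mpr ((n2.1 h2).trans (n1.1 h1)).le)
  · simp only [h1, h2, h3, if_false, not_false_eq_true, if_true]; ring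

def tUA (n : ℕ) : (RA n)ˣ := (tt_unit.map (algebraMap HR (RA n))).unit

lemma tUA_val (n : ℕ) : (tUA n : RA n) = algebraMap HR (RA n) tt := rfl

lemma tUA_comm (n : ℕ) (x : (RA n)ˣ) : Commute (tUA n) x := by
  apply Units.ext
  exact Algebra.commutes _ _

lemma rop_unit {n j : ℕ} (hj : j + 1 < n) : IsUnit (rop n j hj) := by
  have h1 : rop n j hj * (rop n j hj + (1 - tt) • 1) = tUA n := by
    rw [mul_add, rop_quad, mul_smul_comm, mul_one, tUA_val]; module
  have h2 : (rop n j hj + (1 - tt) • 1) * rop n j hj = tUA n := by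
    rw [add_mul, rop_quad, smul_mul_assoc, one_mul, tUA_val]; module
  have hu : IsUnit (rop n j hj * (rop n j hj + (1 - tt) • 1)) := by rw [h1]; exact (tUA n).isUnit
  have hc : Commute (rop n j hj) (rop n j hj + (1 - tt) • 1) := by
    unfold Commute SemiconjBy; rw [h1, h2]
  exact (hc.isUnit_mul_iff.1 hu).1

def rU (n j : ℕ) : (RA n)ˣ := if hj : j + 1 < n then (rop_unit hj).unit else 1

lemma rU_val {n j : ℕ} (hj : j + 1 < n) : (rU n j : RA n) = rop n j hj := by
  rw [rU, dif_pos hj]; rfl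

lemma rU_comm (n : ℕ) (i k : ℕ) (hik : i + 1 < k) (hk : k + 1 < n) :
    Commute (rU n i) (rU n k) := by
  apply Units.ext
  rw [Units.val_mul, Units.val_mul, rU_val hk, rU_val (j := i) (by omega), rop_comm _ hik]

lemma rU_braid (n : ℕ) (i : ℕ) (hi : i + 2 < n) :
    rU n i * rU n (i + 1) * rU n i = rU n (i + 1) * rU n i * rU n (i + 1) := by
  apply Units.ext
  simp only [Units.val_mul]
  rw [rU_val (j := i + 1) hi, rU_val (j := i) (by omega), rop_braid]

def rX (n : ℕ) (k : ℕ) : (RA n)ˣ := JMx (rU n) (tUA n) k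

def rgen (n : ℕ) : AGen n → RA n
  | .T j => rU n j
  | .X i => rX n i
  | .Xinv i => ↑(rX n i)⁻¹

def rFA (n : ℕ) : FA n →ₐ[HR] RA n := FreeAlgebra.lift HR (rgen n)

lemma rFA_T (n j : ℕ) : rFA n (fT n j) = rU n j := by
  simp [rFA, fT, rgen]
lemma rFA_X (n : ℕ) (i : Fin n) : rFA n (fX n i) = rX n i := by
  simp [rFA, fX, rgen]
lemma rFA_Xi (n : ℕ) (i : Fin n) : rFA n (fXi n i) = ↑(rX n i)⁻¹ := by
  simp [rFA, fXi, rgen]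

lemma rFA_rel (n : ℕ) ⦃x y : FA n⦄ (h : ARel n x y) : rFA n x = rFA n y := by
  have c2 := JMx_comm2 n (rU n) (tUA n) (tUA_comm n) (rU_comm n) (rU_braid n)
  have c1 := JMx_comm1 n (rU n) (tUA n) (tUA_comm n) (rU_comm n)
  have c3 := JMx_comm3 n (rU n) (tUA n) (tUA_comm n) (rU_comm n) (rU_braid n)
  induction h with
  | junk j h => rw [rFA_T, map_one, rU, dif_neg h]; rfl
  | quad j h =>
    rw [map_mul, map_add, map_smul, rFA_T, AlgHom.commutes, rU_val h, rop_quad]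
  | braid j h =>
    simp only [map_mul, rFA_T]
    exact congrArg Units.val (rU_braid n j h)
  | commT j k hjk hk =>
    simp only [map_mul, rFA_T]
    exact congrArg Units.val (rU_comm n j k hjk hk)
  | commX i i' =>
    simp only [map_mul, rFA_X]
    have : Commute (rX n i) (rX n i') := by
      rcases lt_trichotomy (i : ℕ) i' with h | h | h
      · exact c3 i' i'.2 i h
      · rw [h]
      · exact (c3 i i.2 i' h).symm
    exact congrArg Units.val this
  | XinvL i => simp only [map_mul, map_one, rFA_X, rFA_Xi, Units.mul_inv]
  | XinvR i => simp only [map_mul, map_one, rFA_X, rFA_Xi, Units.inv_mul]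
  | TXT j h =>
    simp only [map_mul, map_smul, rFA_X, rFA_T]
    rw [Algebra.smul_def, ← tUA_val, ← Units.val_mul, ← Units.val_mul, ← Units.val_mul]
    congr 1
    simp only [rX, JMx]
    rw [mul_inv_cancel_left]
  | TXcomm j h i h1 h2 =>
    simp only [map_mul, rFA_X, rFA_T]
    have : Commute (rU n j) (rX n i) := by
      rcases lt_or_gt_of_ne h1 with h3 | h3
      · exact c1 i j h3 h
      · exact c2 i j (by omega) i.2
    exact congrArg Units.val this

def rho (n : ℕ) : H n →ₐ[HR] RA n := RingQuot.liftAlgHom HR ⟨rFA n, rFA_rel n⟩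

lemma rho_T {n j : ℕ} (hj : j + 1 < n) : rho n (Tg n j) = rop n j hj := by
  rw [Tg, rho, RingQuot.liftAlgHom_mkAlgHom_apply, rFA_T, rU_val hj]

def delta (n : ℕ) (w : Equiv.Perm (Fin n)) : Equiv.Perm (Fin n) → HR := fun x => if x = w then 1 else 0

def ev (n : ℕ) : H n →ₗ[HR] (Equiv.Perm (Fin n) → HR) :=
  (LinearMap.applyₗ (delta n 1)).comp (rho n).toLinearMap

lemma ev_T {n j : ℕ} (hj : j + 1 < n) (h : H n) (w : Equiv.Perm (Fin n)) :
    ev n (Tg n j * h) w = if asc n j hj w then tt * ev n h (sgen n j * w)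
    else ev n h (sgen n j * w) + (tt - 1) * ev n h w := by
  have : ev n (Tg n j * h) = rop n j hj (ev n h) := by
    simp only [ev, LinearMap.comp_apply, AlgHom.toLinearMap_apply, map_mul, rho_T hj]
    rfl
  rw [this, rop_apply]

lemma sgen_mul_eq_iff {n : ℕ} (j : ℕ) (x w : Equiv.Perm (Fin n)) :
    sgen n j * x = w ↔ x = sgen n j * w := by
  constructor
  · rintro rfl; rw [sgen_sgen]
  · rintro rfl; rw [sgen_sgen]

lemma ev_Tw (n : ℕ) : ∀ (N : ℕ) (w : Equiv.Perm (Fin n)), (invs n w).card = N →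
    ev n (Tw n w) = delta n w := by
  intro N
  induction N with
  | zero =>
    intro w hw
    have : w = 1 := by
      by_contra h
      obtain ⟨j, hj, hd⟩ := exists_desc w h
      have := invs_desc hj w hd
      omega
    subst this
    rw [Tw_one]
    simp only [ev, LinearMap.comp_apply, AlgHom.toLinearMap_apply, map_one]
    rfl
  | succ N ih =>
    intro w hw
    by_cases h : w = 1
    · subst h; rw [invs_one] at hw; omega
    obtain ⟨j, hj, hd⟩ := exists_desc w h
    have := invs_desc hj w hd
    rw [Tw_desc hj hd]
    funext x
    rw [ev_T hj, ih _ (by omega)]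
    simp only [delta, sgen_mul_eq_iff, sgen_sgen]
    by_cases hx : x = w
    · subst hx
      rw [if_neg hd]
      have : x ≠ sgen n j * x := by
        intro h
        have h2 := (asc_sgen hj x).2 hd
        rw [← h] at h2; exact hd h2
      simp [this]
    · simp only [hx, if_false]
      split_ifs with h1 h2
      · simp
      · subst h2; exact absurd ((asc_sgen hj w).2 hd) h1
      · simp

lemma ev_Tw' (n : ℕ) (w : Equiv.Perm (Fin n)) : ev n (Tw n w) = delta n w := ev_Tw n _ w rfl

lemma MM_expand {n : ℕ} {h : H n} (hh : h ∈ MM n) : h = ∑ w, ev n h w • Tw n w := by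
  induction hh using Submodule.span_induction with
  | mem x h =>
    obtain ⟨w, rfl⟩ := h
    rw [ev_Tw']; simp [delta]
  | zero => simp
  | add x y _ _ h1 h2 =>
    conv_lhs => rw [h1, h2]
    rw [← Finset.sum_add_distrib]
    apply Finset.sum_congr rfl; intro w _
    rw [map_add, Pi.add_apply, add_smul]
  | smul a x _ h =>
    conv_lhs => rw [h]
    rw [Finset.smul_sum]
    apply Finset.sum_congr rfl; intro w _
    rw [map_smul, Pi.smul_apply, smul_smul, smul_eq_mul]

lemma perm_apply_inv {n : ℕ} (w : Equiv.Perm (Fin n)) (x : Fin n) : w (w⁻¹ x) = x := Equiv.apply_symm_apply w x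
lemma perm_inv_apply {n : ℕ} (w : Equiv.Perm (Fin n)) (x : Fin n) : w⁻¹ (w x) = x := Equiv.symm_apply_apply w x

lemma colPerm_lt {n : ℕ} (C : Finset (Fin n)) (x : Fin n) (h : (x : ℕ) < C.card) :
    colPerm n C x = C.orderEmbOfFin rfl ⟨x, h⟩ := by
  have e : (finCongr ((Nat.add_sub_cancel' (col_card_le n C)).symm)) x
      = Fin.castAdd (n - C.card) ⟨x, h⟩ := by
    apply Fin.ext; simp
  simp only [colPerm, Equiv.trans_apply]
  rw [e, finSumFinEquiv_symm_apply_castAdd]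
  rfl

lemma card_compl' {n : ℕ} (C : Finset (Fin n)) : Cᶜ.card = n - C.card := by
  simp [Finset.card_compl]

lemma colPerm_ge {n : ℕ} (C : Finset (Fin n)) (x : Fin n) (h : C.card ≤ (x : ℕ)) :
    colPerm n C x = Cᶜ.orderEmbOfFin (card_compl' C) ⟨x - C.card, by omega⟩ := by
  have e : (finCongr ((Nat.add_sub_cancel' (col_card_le n C)).symm)) x
      = Fin.natAdd C.card ⟨x - C.card, by omega⟩ := by
    apply Fin.ext; simp; omega
  simp only [colPerm, Equiv.trans_apply]
  rw [e, finSumFinEquiv_symm_apply_natAdd]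
  rfl

lemma colPerm_mem {n : ℕ} (C : Finset (Fin n)) (x : Fin n) :
    colPerm n C x ∈ C ↔ (x : ℕ) < C.card := by
  by_cases h : (x : ℕ) < C.card
  · simp only [h, iff_true]
    rw [colPerm_lt C x h]
    exact Finset.orderEmbOfFin_mem _ _ _
  · simp only [h, iff_false]
    rw [colPerm_ge C x (by omega), ← Finset.mem_compl]
    exact Finset.orderEmbOfFin_mem _ _ _

lemma colPerm_mono {n : ℕ} (C : Finset (Fin n)) {x y : Fin n} (hxy : x < y)
    (h : (x : ℕ) < C.card ↔ (y : ℕ) < C.card) : colPerm n C x < colPerm n C y := by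
  by_cases hx : (x : ℕ) < C.card
  · rw [colPerm_lt C x hx, colPerm_lt C y (h.1 hx)]
    simpa using hxy
  · have hy : ¬ (y : ℕ) < C.card := fun hy => hx (h.2 hy)
    rw [colPerm_ge C x (by omega), colPerm_ge C y (by omega)]
    simp only [OrderEmbedding.lt_iff_lt, Fin.lt_def] at *
    omega

lemma colPerm_inv_lt {n : ℕ} (C : Finset (Fin n)) (y : Fin n) :
    (((colPerm n C)⁻¹ y : Fin n) : ℕ) < C.card ↔ y ∈ C := by
  rw [← colPerm_mem, perm_apply_inv]

lemma colPerm_unique {n : ℕ} (C : Finset (Fin n)) (w : Equiv.Perm (Fin n))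
    (h1 : ∀ x, w x ∈ C ↔ (x : ℕ) < C.card)
    (h2 : ∀ x y : Fin n, x < y → ((x : ℕ) < C.card ↔ (y : ℕ) < C.card) → w x < w y) :
    w = colPerm n C := by
  have : (colPerm n C)⁻¹ * w = 1 := by
    apply perm_eq_one_of_mono
    intro x y hxy
    simp only [Equiv.Perm.mul_apply]
    have hx : (((colPerm n C)⁻¹ (w x) : Fin n) : ℕ) < C.card ↔ (x : ℕ) < C.card := by
      rw [colPerm_inv_lt, h1]
    have hy : (((colPerm n C)⁻¹ (w y) : Fin n) : ℕ) < C.card ↔ (y : ℕ) < C.card := by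
      rw [colPerm_inv_lt, h1]
    by_cases hb : ((x : ℕ) < C.card ↔ (y : ℕ) < C.card)
    · have hw := h2 x y hxy hb
      by_contra hc
      rcases (not_lt.mp hc).lt_or_eq with h | h
      · have := colPerm_mono C h (by rw [hx, hy]; exact hb.symm)
        rw [perm_apply_inv, perm_apply_inv] at this
        exact absurd hw (not_lt.mpr this.le)
      · have := (colPerm n C)⁻¹.injective h
        rw [this] at hw
        exact lt_irrefl _ hw
    · rw [Fin.lt_def] at *
      by_cases hx' : (x : ℕ) < C.card
      · have : ¬ (y : ℕ) < C.card := fun h => hb ⟨fun _ => h, fun _ => hx'⟩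
        have a := hx.2 hx'
        have b := mt hy.1 this
        omega
      · exfalso; apply hb
        constructor <;> intro <;> omega
  rw [inv_mul_eq_one] at this
  exact this.symm

lemma sCol_card (n j : ℕ) (C : Finset (Fin n)) : (sCol n j C).card = C.card :=
  Finset.card_image_of_injective _ (sgen n j).injective

lemma mem_sCol {n j : ℕ} (C : Finset (Fin n)) (x : Fin n) : x ∈ sCol n j C ↔ sgen n j x ∈ C := by
  simp only [sCol, Finset.mem_image]
  constructor
  · rintro ⟨y, hy, rfl⟩; rwa [sgen_app_app]
  · intro h; exact ⟨_, h, sgen_app_app n j x⟩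

lemma sCol_sCol (n j : ℕ) (C : Finset (Fin n)) : sCol n j (sCol n j C) = C := by
  ext x; rw [mem_sCol, mem_sCol, sgen_app_app]

/-- `C` contains exactly one of `j`, `j+1`. -/
lemma colPerm_sCol {n j : ℕ} (hj : j + 1 < n) (C : Finset (Fin n))
    (h : ¬ ((⟨j, Nat.lt_of_succ_lt hj⟩ : Fin n) ∈ C ↔ (⟨j + 1, hj⟩ : Fin n) ∈ C)) :
    colPerm n (sCol n j C) = sgen n j * colPerm n C := by
  symm
  apply colPerm_unique
  · intro x
    rw [mem_sCol, Equiv.Perm.mul_apply, sgen_app_app, sCol_card, colPerm_mem]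
  · intro x y hxy hb
    rw [sCol_card] at hb
    have hlt := colPerm_mono C hxy hb
    simp only [Equiv.Perm.mul_apply]
    apply sgen_lt hj hlt
    rintro ⟨e1, e2⟩
    apply h
    have e1' : colPerm n C x = ⟨j, Nat.lt_of_succ_lt hj⟩ := Fin.ext e1
    have e2' : colPerm n C y = ⟨j + 1, hj⟩ := Fin.ext e2
    rw [← e1', ← e2', colPerm_mem, colPerm_mem]
    exact hb

lemma sCol_neutral {n j : ℕ} (hj : j + 1 < n) (C : Finset (Fin n))
    (h : ((⟨j, Nat.lt_of_succ_lt hj⟩ : Fin n) ∈ C ↔ (⟨j + 1, hj⟩ : Fin n) ∈ C)) :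
    sCol n j C = C := by
  ext x
  rw [mem_sCol]
  by_cases h1 : (x : ℕ) = j
  · have : x = ⟨j, Nat.lt_of_succ_lt hj⟩ := Fin.ext h1
    rw [this, sgen_j hj]; exact h.symm
  · by_cases h2 : (x : ℕ) = j + 1
    · have : x = ⟨j + 1, hj⟩ := Fin.ext h2
      rw [this, sgen_j1 hj]; exact h
    · rw [sgen_ne hj x h1 h2]

lemma neutral_adj {n j : ℕ} (hj : j + 1 < n) (C : Finset (Fin n))
    (h : ((⟨j, Nat.lt_of_succ_lt hj⟩ : Fin n) ∈ C ↔ (⟨j + 1, hj⟩ : Fin n) ∈ C)) :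
    ∃ p, ∃ hp : p + 1 < n, (colPerm n C)⁻¹ ⟨j, Nat.lt_of_succ_lt hj⟩ = ⟨p, Nat.lt_of_succ_lt hp⟩ ∧
      (colPerm n C)⁻¹ ⟨j + 1, hj⟩ = ⟨p + 1, hp⟩ ∧ (p < C.card ↔ p + 1 < C.card) := by
  set u := colPerm n C with hu
  have hb := h
  rw [← colPerm_inv_lt, ← colPerm_inv_lt, ← hu] at hb
  set p := u⁻¹ ⟨j, Nat.lt_of_succ_lt hj⟩ with hp
  set q := u⁻¹ ⟨j + 1, hj⟩ with hq
  have up : u p = ⟨j, Nat.lt_of_succ_lt hj⟩ := by rw [hp, perm_apply_inv]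
  have uq : u q = ⟨j + 1, hj⟩ := by rw [hq, perm_apply_inv]
  have hpq : p < q := by
    by_contra hc
    rcases (not_lt.mp hc).lt_or_eq with h | h
    · have := colPerm_mono C h hb.symm
      rw [← hu, up, uq, Fin.lt_def] at this
      simp at this
    · rw [h, up] at uq
      simp at uq
  have hval : (q : ℕ) = p + 1 := by
    by_contra hc
    have hpq' : (p : ℕ) < q := hpq
    have hx : (p : ℕ) + 1 < n := by omega
    set x : Fin n := ⟨p + 1, hx⟩ with hxdef
    have hxv : (x : ℕ) = p + 1 := rfl
    have h1 := colPerm_mono C (x := p) (y := x) (by rw [Fin.lt_def]; omega)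
      ⟨fun hh => by have := hb.1 hh; omega, fun hh => by omega⟩
    have h2 := colPerm_mono C (x := x) (y := q) (by rw [Fin.lt_def]; omega)
      ⟨fun hh => hb.1 (by omega), fun hh => by omega⟩
    rw [← hu, up, Fin.lt_def] at h1
    rw [← hu, uq, Fin.lt_def] at h2
    simp at h1 h2
    omega
  refine ⟨p, by omega, rfl, Fin.ext hval, ?_⟩
  rw [hb, hval]

/-- stabilizer condition -/
lemma stab_iff {n ℓ : ℕ} (v : Equiv.Perm (Fin n)) :
    wAct n v (varpi n ℓ) = varpi n ℓ ↔ ∀ x : Fin n, ((v x : Fin n) : ℕ) < ℓ ↔ (x : ℕ) < ℓ := by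
  have key : ∀ a b : Fin n, varpi n ℓ a = varpi n ℓ b ↔ ((a : ℕ) < ℓ ↔ (b : ℕ) < ℓ) := by
    intro a b
    unfold varpi
    split_ifs <;> simp [*]
  constructor
  · intro h x
    have := congrFun h (v x)
    simp only [wAct, perm_inv_apply] at this
    exact ((key _ _).1 this).symm
  · intro h
    funext x
    simp only [wAct]
    rw [key]
    have := h (v⁻¹ x)
    rw [perm_apply_inv] at this
    exact this.symm

lemma stab_inv {n ℓ : ℕ} {v : Equiv.Perm (Fin n)} (h : wAct n v (varpi n ℓ) = varpi n ℓ) (x : Fin n) :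
    ((v⁻¹ x : Fin n) : ℕ) < ℓ ↔ (x : ℕ) < ℓ := by
  have := (stab_iff v).1 h (v⁻¹ x)
  rw [perm_apply_inv] at this
  exact this.symm

/-- T_{u_E} T_v = T_{u_E v} -/
lemma Tw_colPerm_mul (n : ℕ) : ∀ (N : ℕ) (C : Finset (Fin n)) (v : Equiv.Perm (Fin n)),
    (invs n (colPerm n C)).card = N → wAct n v (varpi n C.card) = varpi n C.card →
    Tw n (colPerm n C * v) = Tw n (colPerm n C) * Tw n v := by
  intro N
  induction N with
  | zero =>
    intro C v hw hv
    have : colPerm n C = 1 := by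
      by_contra h
      obtain ⟨j, hj, hd⟩ := exists_desc _ h
      have := invs_desc hj _ hd
      omega
    rw [this, Tw_one, one_mul, one_mul]
  | succ N ih =>
    intro C v hw hv
    by_cases h : colPerm n C = 1
    · rw [h, invs_one] at hw; omega
    obtain ⟨j, hj, hd⟩ := exists_desc _ h
    have hinv := invs_desc hj _ hd
    have hd' := (not_asc_iff hj _).1 hd
    have hne : ¬ ((⟨j, Nat.lt_of_succ_lt hj⟩ : Fin n) ∈ C ↔ (⟨j + 1, hj⟩ : Fin n) ∈ C) := by
      intro hiff
      have := colPerm_mono C hd' (by rw [colPerm_inv_lt, colPerm_inv_lt]; exact hiff.symm)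
      rw [perm_apply_inv, perm_apply_inv, Fin.lt_def] at this
      simp at this
    have hs := colPerm_sCol hj C hne
    have hCu : colPerm n C = sgen n j * colPerm n (sCol n j C) := by rw [hs, sgen_sgen]
    have ih' := ih (sCol n j C) v (by rw [hs]; omega) (by rw [sCol_card]; exact hv)
    have hlt : (((colPerm n C)⁻¹ ⟨j + 1, hj⟩ : Fin n) : ℕ) < C.card ∧
        ¬ (((colPerm n C)⁻¹ ⟨j, Nat.lt_of_succ_lt hj⟩ : Fin n) : ℕ) < C.card := by
      have e1 := colPerm_inv_lt C ⟨j + 1, hj⟩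
      have e2 := colPerm_inv_lt C ⟨j, Nat.lt_of_succ_lt hj⟩
      rw [← e1, ← e2] at hne
      rw [Fin.lt_def] at hd'
      by_contra hc
      apply hne
      constructor
      · intro; omega
      · intro hh; by_contra h3; exact hc ⟨hh, h3⟩
    rw [Tw_desc hj hd, ← hs, hCu, mul_assoc, mul_assoc, ← ih', Tw_asc hj]
    rw [hs, mul_assoc, asc_sgen, not_asc_iff, mul_inv_rev, Equiv.Perm.mul_apply,
      Equiv.Perm.mul_apply, Fin.lt_def]
    have e1 := stab_inv hv ((colPerm n C)⁻¹ ⟨j + 1, hj⟩)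
    have e2 := stab_inv hv ((colPerm n C)⁻¹ ⟨j, Nat.lt_of_succ_lt hj⟩)
    have := e1.2 hlt.1
    have := mt e2.1 hlt.2
    omega

lemma Tw_colPerm_mul' {n : ℕ} {C : Finset (Fin n)} {v : Equiv.Perm (Fin n)} 
    (h : wAct n v (varpi n C.card) = varpi n C.card) :
    Tw n (colPerm n C * v) = Tw n (colPerm n C) * Tw n v := Tw_colPerm_mul n _ C v rfl h

/-- image of the first `ℓ` letters -/
def firstIm (n ℓ : ℕ) (w : Equiv.Perm (Fin n)) : Finset (Fin n) := (hwCol n ℓ).image w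

lemma hwCol_card {n ℓ : ℕ} (h : ℓ ≤ n) : (hwCol n ℓ).card = ℓ := by
  have : (hwCol n ℓ) = (Finset.univ : Finset (Fin ℓ)).map (Fin.castLEEmb h) := by
    ext x
    simp only [hwCol, Finset.mem_filter, Finset.mem_univ, true_and, Finset.mem_map, Fin.castLEEmb_apply]
    constructor
    · intro hx; exact ⟨⟨x, hx⟩, rfl⟩
    · rintro ⟨y, rfl⟩; exact y.2
  rw [this]; simp

lemma mem_hwCol {n ℓ : ℕ} (x : Fin n) : x ∈ hwCol n ℓ ↔ (x : ℕ) < ℓ := by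
  simp [hwCol]

lemma firstIm_card {n ℓ : ℕ} (h : ℓ ≤ n) (w : Equiv.Perm (Fin n)) : (firstIm n ℓ w).card = ℓ := by
  rw [firstIm, Finset.card_image_of_injective _ w.injective, hwCol_card h]

lemma mem_firstIm {n ℓ : ℕ} (w : Equiv.Perm (Fin n)) (y : Fin n) :
    y ∈ firstIm n ℓ w ↔ ((w⁻¹ y : Fin n) : ℕ) < ℓ := by
  simp only [firstIm, Finset.mem_image, mem_hwCol]
  constructor
  · rintro ⟨x, hx, rfl⟩; rwa [perm_inv_apply]
  · intro h; exact ⟨_, h, perm_apply_inv w y⟩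

lemma mem_stab {n ℓ : ℕ} (v : Equiv.Perm (Fin n)) :
    v ∈ stabFinset n (varpi n ℓ) ↔ wAct n v (varpi n ℓ) = varpi n ℓ := by
  simp [stabFinset]

lemma mem_colF {n ℓ : ℕ} (C : Finset (Fin n)) : C ∈ colFinset n ℓ ↔ C.card = ℓ := by
  simp [colFinset]

lemma firstIm_mul {n : ℕ} (F : Finset (Fin n)) (v : Equiv.Perm (Fin n))
    (hv : wAct n v (varpi n F.card) = varpi n F.card) :
    firstIm n F.card (colPerm n F * v) = F := by
  ext y
  rw [mem_firstIm, mul_inv_rev, Equiv.Perm.mul_apply, stab_inv hv, colPerm_inv_lt]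

lemma coset_inj {n ℓ : ℕ} {F C : Finset (Fin n)} {v w : Equiv.Perm (Fin n)} (hF : F.card = ℓ)
    (hC : C.card = ℓ) (hv : wAct n v (varpi n ℓ) = varpi n ℓ) (hw : wAct n w (varpi n ℓ) = varpi n ℓ) :
    colPerm n F * v = colPerm n C * w ↔ F = C ∧ v = w := by
  constructor
  · intro h
    have e : F = C := by
      have h1 := firstIm_mul F v (by rw [hF]; exact hv)
      have h2 := firstIm_mul C w (by rw [hC]; exact hw)
      rw [hF, h] at h1
      rw [hC] at h2
      rw [← h1, h2]
    subst e
    exact ⟨rfl, mul_left_cancel h⟩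
  · rintro ⟨rfl, rfl⟩; rfl

lemma coset_sum {n ℓ : ℕ} (hℓ : ℓ ≤ n) {M : Type*} [AddCommMonoid M] (G : Equiv.Perm (Fin n) → M) :
    ∑ F ∈ colFinset n ℓ, ∑ v ∈ stabFinset n (varpi n ℓ), G (colPerm n F * v) = ∑ w, G w := by
  rw [← Finset.sum_product']
  refine Finset.sum_bij (fun p _ => colPerm n p.1 * p.2) (fun _ _ => Finset.mem_univ _) ?_ ?_ ?_
  · rintro ⟨F, v⟩ h1 ⟨C, w⟩ h2 h
    simp only [Finset.mem_product, mem_stab, mem_colF] at h1 h2 h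
    obtain ⟨rfl, rfl⟩ := (coset_inj h1.1 h2.1 h1.2 h2.2).1 h
    rfl
  · intro w _
    refine ⟨(firstIm n ℓ w, (colPerm n (firstIm n ℓ w))⁻¹ * w), ?_, by simp⟩
    simp only [Finset.mem_product, mem_stab, mem_colF]
    refine ⟨firstIm_card hℓ w, ?_⟩
    rw [stab_iff]
    intro x
    have := colPerm_inv_lt (firstIm n ℓ w) (w x)
    rw [firstIm_card hℓ, mem_firstIm, perm_inv_apply] at this
    rw [Equiv.Perm.mul_apply]
    exact this
  · intros; rfl

/-- the coefficient map -/
def coef (n : ℕ) (C : Finset (Fin n)) (h : H n) : H n :=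
  ∑ v ∈ stabFinset n (varpi n C.card), ev n h (colPerm n C * v) • Tw n v

lemma coef_add (n : ℕ) (C : Finset (Fin n)) (h k : H n) : coef n C (h + k) = coef n C h + coef n C k := by
  simp only [coef, map_add, Pi.add_apply, add_smul, Finset.sum_add_distrib]

lemma coef_smul (n : ℕ) (C : Finset (Fin n)) (a : HR) (h : H n) : coef n C (a • h) = a • coef n C h := by
  simp only [coef, map_smul, Pi.smul_apply, smul_eq_mul, mul_smul, Finset.smul_sum]

lemma coef_sum (n : ℕ) (C : Finset (Fin n)) {ι : Type*} (s : Finset ι) (f : ι → H n) :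
    coef n C (∑ i ∈ s, f i) = ∑ i ∈ s, coef n C (f i) := by
  induction s using Finset.induction_on with
  | empty => simp [coef]
  | insert a s ha ih => rw [Finset.sum_insert ha, Finset.sum_insert ha, coef_add, ih]

lemma coef_mem_para (n : ℕ) (C : Finset (Fin n)) (h : H n) : coef n C h ∈ HparaM n (varpi n C.card) := by
  unfold coef
  apply Submodule.sum_mem
  intro v hv
  apply Submodule.smul_mem
  apply Submodule.subset_span
  exact ⟨v, (mem_stab v).1 hv, rfl⟩

lemma coef_mem (n : ℕ) (C : Finset (Fin n)) (h : H n) : coef n C h ∈ MM n := by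
  unfold coef
  apply Submodule.sum_mem
  intro v hv
  apply Submodule.smul_mem
  exact Tw_mem n v

lemma coef_exists {n ℓ : ℕ} (hℓ : ℓ ≤ n) {h : H n} (hh : h ∈ MM n) :
    h = ∑ F ∈ colFinset n ℓ, Tw n (colPerm n F) * coef n F h := by
  conv_lhs => rw [MM_expand hh, ← coset_sum hℓ]
  apply Finset.sum_congr rfl
  intro F hF
  rw [mem_colF] at hF
  subst hF
  unfold coef
  rw [Finset.mul_sum]
  apply Finset.sum_congr rfl
  intro v hv
  rw [Tw_colPerm_mul' ((mem_stab v).1 hv), mul_smul_comm]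

lemma coef_unique {n ℓ : ℕ} {F C : Finset (Fin n)} (hF : F.card = ℓ) (hC : C.card = ℓ) {g : H n}
    (hg : g ∈ HparaM n (varpi n ℓ)) :
    coef n C (Tw n (colPerm n F) * g) = if F = C then g else 0 := by
  induction hg using Submodule.span_induction with
  | mem x hx =>
    obtain ⟨w, hw, rfl⟩ := hx
    have hw' : wAct n w (varpi n ℓ) = varpi n ℓ := hw
    rw [← Tw_colPerm_mul' (by rw [hF]; exact hw)]
    unfold coef
    rw [ev_Tw', hC]
    have : ∀ v ∈ stabFinset n (varpi n ℓ), delta n (colPerm n F * w) (colPerm n C * v) • Tw n v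
        = if v = w then (if F = C then Tw n w else 0) else 0 := by
      intro v hv
      have hi := coset_inj hF hC hw' ((mem_stab v).1 hv)
      by_cases e : v = w <;> by_cases e' : F = C
      · simp [delta, e, e']
      · have : colPerm n C * v ≠ colPerm n F * w := fun h => e' (hi.1 h.symm).1
        simp [delta, e, e']
        intro h; subst e; exact absurd (by rw [h]) this
      · have : colPerm n C * v ≠ colPerm n F * w := fun h => e (hi.1 h.symm).2.symm
        simp [delta, this, e]
      · have : colPerm n C * v ≠ colPerm n F * w := fun h => e (hi.1 h.symm).2.symm
        simp [delta, this, e]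
    rw [Finset.sum_congr rfl this, Finset.sum_ite_eq' , if_pos ((mem_stab w).2 hw')]
  | zero => simp [coef]
  | add x y _ _ hx hy =>
    rw [mul_add, coef_add, hx, hy]
    split_ifs <;> simp
  | smul a x _ hx =>
    rw [mul_smul_comm, coef_smul, hx]
    split_ifs <;> simp

lemma paraCoeff_eq {n : ℕ} (C : Finset (Fin n)) {h : H n} (hh : h ∈ MM n) :
    paraCoeff n C.card h C = coef n C h := by
  have hex : ∃ g : Finset (Fin n) → H n,
      (∀ F : Finset (Fin n), F.card = C.card → g F ∈ HparaM n (varpi n C.card)) ∧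
      h = ∑ F ∈ colFinset n C.card, Tw n (colPerm n F) * g F :=
    ⟨fun F => coef n F h, fun F hF => by have := coef_mem_para n F h; rwa [hF] at this,
      coef_exists (col_card_le n C) hh⟩
  unfold paraCoeff
  rw [dif_pos hex]
  obtain ⟨h1, h2⟩ := hex.choose_spec
  have := congrArg (coef n C) h2
  rw [coef_sum, Finset.sum_congr rfl (fun F hF => coef_unique ((mem_colF F).1 hF) rfl
    (h1 F ((mem_colF F).1 hF))), Finset.sum_ite_eq', if_pos ((mem_colF C).2 rfl)] at this
  exact this.symm

lemma ev_one0 (n : ℕ) (w : Equiv.Perm (Fin n)) : ev n (one0 n) w = 1 := by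
  unfold one0
  rw [map_sum, Finset.sum_apply]
  simp [ev_Tw', delta]

lemma coef_one0 (n : ℕ) (C : Finset (Fin n)) : coef n C (one0 n) = onePara n (varpi n C.card) := by
  unfold coef onePara
  simp [ev_one0]

lemma one0_mem (n : ℕ) : one0 n ∈ MM n := Submodule.sum_mem _ fun w _ => Tw_mem n w

/-- `t^{ℓ(u)} T_{u^{-1}}^{-1}` -/
def Ti (n : ℕ) (C : Finset (Fin n)) : H n :=
  tpow n (len n (colPerm n C)) * Ring.inverse (Tw n (colPerm n C)⁻¹)

lemma tpow_mul (n k : ℕ) (x : H n) : tpow n k * x = tt ^ k • x := by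
  rw [tpow, Algebra.smul_def]

lemma Ti_mul_mem {n : ℕ} (C : Finset (Fin n)) {x : H n} (hx : x ∈ MM n) : Ti n C * x ∈ MM n := by
  unfold Ti
  rw [mul_assoc, tpow_mul]
  apply Submodule.smul_mem
  apply inv_TofWord_mul_mem n _ _ x hx
  exact (redWord_spec _ _).1

lemma Psi_aux (n : ℕ) : ∀ S : List (Finset (Fin n)), Psi n S ∈ MM n ∧
    ∀ C, Psi n (C :: S) = Ti n C * coef n C (Psi n S) := by
  intro S
  induction S with
  | nil =>
    refine ⟨one0_mem n, fun C => ?_⟩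
    rw [show Psi n [] = one0 n from rfl, coef_one0]; rfl
  | cons D S ih =>
    have hm : Psi n (D :: S) ∈ MM n := by
      rw [ih.2]; exact Ti_mul_mem D (coef_mem _ _ _)
    refine ⟨hm, fun C => ?_⟩
    rw [← paraCoeff_eq C hm]; rfl

lemma Psi_cons (n : ℕ) (C : Finset (Fin n)) (S : List (Finset (Fin n))) :
    Psi n (C :: S) = Ti n C * coef n C (Psi n S) := (Psi_aux n S).2 C

lemma Psi_mem (n : ℕ) (S : List (Finset (Fin n))) : Psi n S ∈ MM n := (Psi_aux n S).1

lemma asc_up {n j : ℕ} (hj : j + 1 < n) (C : Finset (Fin n)) {v : Equiv.Perm (Fin n)}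
    (h1 : (⟨j, Nat.lt_of_succ_lt hj⟩ : Fin n) ∈ C) (h2 : (⟨j + 1, hj⟩ : Fin n) ∉ C)
    (hv : wAct n v (varpi n C.card) = varpi n C.card) : asc n j hj (colPerm n C * v) := by
  unfold asc
  rw [mul_inv_rev, Equiv.Perm.mul_apply, Equiv.Perm.mul_apply, Fin.lt_def]
  rw [← colPerm_inv_lt, ← stab_inv hv] at h1 h2
  omega

lemma asc_down {n j : ℕ} (hj : j + 1 < n) (C : Finset (Fin n)) {v : Equiv.Perm (Fin n)}
    (h1 : (⟨j, Nat.lt_of_succ_lt hj⟩ : Fin n) ∉ C) (h2 : (⟨j + 1, hj⟩ : Fin n) ∈ C)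
    (hv : wAct n v (varpi n C.card) = varpi n C.card) : ¬ asc n j hj (colPerm n C * v) := by
  unfold asc
  rw [mul_inv_rev, Equiv.Perm.mul_apply, Equiv.Perm.mul_apply, Fin.lt_def]
  rw [← colPerm_inv_lt, ← stab_inv hv] at h1 h2
  omega

lemma coef_up {n j : ℕ} (hj : j + 1 < n) (C : Finset (Fin n)) (h : H n)
    (h1 : (⟨j, Nat.lt_of_succ_lt hj⟩ : Fin n) ∈ C) (h2 : (⟨j + 1, hj⟩ : Fin n) ∉ C) :
    coef n C (Tg n j * h) = tt • coef n (sCol n j C) h := by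
  unfold coef
  rw [sCol_card, Finset.smul_sum]
  apply Finset.sum_congr rfl
  intro v hv
  rw [ev_T hj, if_pos (asc_up hj C h1 h2 ((mem_stab v).1 hv)), colPerm_sCol hj C (by tauto),
    mul_assoc, smul_smul]

lemma coef_down {n j : ℕ} (hj : j + 1 < n) (C : Finset (Fin n)) (h : H n)
    (h1 : (⟨j, Nat.lt_of_succ_lt hj⟩ : Fin n) ∉ C) (h2 : (⟨j + 1, hj⟩ : Fin n) ∈ C) :
    coef n C (Tg n j * h) = coef n (sCol n j C) h + (tt - 1) • coef n C h := by
  unfold coef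
  rw [sCol_card, Finset.smul_sum, ← Finset.sum_add_distrib]
  apply Finset.sum_congr rfl
  intro v hv
  rw [ev_T hj, if_neg (asc_down hj C h1 h2 ((mem_stab v).1 hv)), colPerm_sCol hj C (by tauto),
    mul_assoc, smul_smul, add_smul]

lemma stab_mul {n ℓ p : ℕ} (hp : p + 1 < n) (hb : p < ℓ ↔ p + 1 < ℓ) (v : Equiv.Perm (Fin n)) :
    wAct n (sgen n p * v) (varpi n ℓ) = varpi n ℓ ↔ wAct n v (varpi n ℓ) = varpi n ℓ := by
  have key : ∀ y : Fin n, ((sgen n p y : Fin n) : ℕ) < ℓ ↔ (y : ℕ) < ℓ := by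
    intro y
    by_cases e1 : (y : ℕ) = p
    · have : y = ⟨p, Nat.lt_of_succ_lt hp⟩ := Fin.ext e1
      rw [this, sgen_j hp]; exact hb.symm
    · by_cases e2 : (y : ℕ) = p + 1
      · have : y = ⟨p + 1, hp⟩ := Fin.ext e2
        rw [this, sgen_j1 hp]; exact hb
      · rw [sgen_ne hp y e1 e2]
  rw [stab_iff, stab_iff]
  simp only [Equiv.Perm.mul_apply, key]

lemma coef_neutral {n j p : ℕ} (hj : j + 1 < n) (C : Finset (Fin n)) (h : H n) (hp : p + 1 < n)
    (h1 : (colPerm n C)⁻¹ ⟨j, Nat.lt_of_succ_lt hj⟩ = ⟨p, Nat.lt_of_succ_lt hp⟩)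
    (h2 : (colPerm n C)⁻¹ ⟨j + 1, hj⟩ = ⟨p + 1, hp⟩) (hb : p < C.card ↔ p + 1 < C.card)
    (hc : sgen n j * colPerm n C = colPerm n C * sgen n p) :
    coef n C (Tg n j * h) = Tg n p * coef n C h := by
  have hasc : ∀ v, asc n j hj (colPerm n C * v) ↔ asc n p hp v := by
    intro v
    unfold asc
    rw [mul_inv_rev, Equiv.Perm.mul_apply, Equiv.Perm.mul_apply, h1, h2]
  have hre : ∀ f : Equiv.Perm (Fin n) → H n, ∑ v ∈ stabFinset n (varpi n C.card), f (sgen n p * v)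
      = ∑ v ∈ stabFinset n (varpi n C.card), f v := by
    intro f
    refine Finset.sum_bij' (fun v _ => sgen n p * v) (fun v _ => sgen n p * v) ?_ ?_ ?_ ?_ ?_
    · intro v hv; rw [mem_stab, stab_mul hp hb]; exact (mem_stab v).1 hv
    · intro v hv; rw [mem_stab, stab_mul hp hb]; exact (mem_stab v).1 hv
    · intro v _; simp only [sgen_sgen]
    · intro v _; simp only [sgen_sgen]
    · intros; rfl
  set E := fun v => ev n h (colPerm n C * v) with hE
  have e1 : coef n C (Tg n j * h) = ∑ v ∈ stabFinset n (varpi n C.card),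
      (if asc n p hp v then tt * E (sgen n p * v) else E (sgen n p * v) + (tt - 1) * E v) • Tw n v := by
    unfold coef
    apply Finset.sum_congr rfl
    intro v _
    rw [ev_T hj]
    simp only [hasc, hE, ← mul_assoc]
    rw [hc]
  have e2 : Tg n p * coef n C h = ∑ v ∈ stabFinset n (varpi n C.card),
      ((if asc n p hp v then 0 else (tt - 1) * E v) • Tw n v
        + (if asc n p hp v then E v else tt * E v) • Tw n (sgen n p * v)) := by
    unfold coef
    rw [Finset.mul_sum]
    apply Finset.sum_congr rfl
    intro v _
    rw [mul_smul_comm, Tg_mul_Tw hp]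
    split_ifs
    · simp [hE]
    · simp only [hE]; module
  have e3 := hre (fun v => (if asc n p hp v then tt * E (sgen n p * v) else E (sgen n p * v)) • Tw n v)
  rw [e1, e2, Finset.sum_add_distrib]
  have e4 : ∑ v ∈ stabFinset n (varpi n C.card),
      (if asc n p hp v then tt * E (sgen n p * v) else E (sgen n p * v) + (tt - 1) * E v) • Tw n v
      = ∑ v ∈ stabFinset n (varpi n C.card), (if asc n p hp v then 0 else (tt - 1) * E v) • Tw n v
       + ∑ v ∈ stabFinset n (varpi n C.card),
        (if asc n p hp v then tt * E (sgen n p * v) else E (sgen n p * v)) • Tw n v := by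
    rw [← Finset.sum_add_distrib]
    apply Finset.sum_congr rfl
    intro v _
    split_ifs <;> module
  rw [e4, ← e3]
  congr 1
  apply Finset.sum_congr rfl
  intro v _
  rw [sgen_sgen]
  have := asc_sgen hp v
  by_cases ha : asc n p hp v
  · rw [if_neg (by tauto), if_pos ha]
  · rw [if_pos (by tauto), if_neg ha]

lemma neutral_comm {n j p : ℕ} (hj : j + 1 < n) (u : Equiv.Perm (Fin n)) (hp : p + 1 < n)
    (h1 : u⁻¹ ⟨j, Nat.lt_of_succ_lt hj⟩ = ⟨p, Nat.lt_of_succ_lt hp⟩)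
    (h2 : u⁻¹ ⟨j + 1, hj⟩ = ⟨p + 1, hp⟩) :
    sgen n j * u = u * sgen n p := by
  have h1' : u ⟨p, Nat.lt_of_succ_lt hp⟩ = ⟨j, Nat.lt_of_succ_lt hj⟩ := by rw [← h1, perm_apply_inv]
  have h2' : u ⟨p + 1, hp⟩ = ⟨j + 1, hj⟩ := by rw [← h2, perm_apply_inv]
  ext x
  congr 1
  simp only [Equiv.Perm.mul_apply]
  by_cases e1 : (x : ℕ) = p
  · have : x = ⟨p, Nat.lt_of_succ_lt hp⟩ := Fin.ext e1
    rw [this, sgen_j hp, h1', h2', sgen_j hj]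
  · by_cases e2 : (x : ℕ) = p + 1
    · have : x = ⟨p + 1, hp⟩ := Fin.ext e2
      rw [this, sgen_j1 hp, h1', h2', sgen_j1 hj]
    · rw [sgen_ne hp x e1 e2, sgen_ne hj]
      · intro h
        have : u x = u ⟨p, Nat.lt_of_succ_lt hp⟩ := by rw [h1']; exact Fin.ext h
        exact e1 (congrArg Fin.val (u.injective this))
      · intro h
        have : u x = u ⟨p + 1, hp⟩ := by rw [h2']; exact Fin.ext h
        exact e2 (congrArg Fin.val (u.injective this))

lemma Ti_down {n j : ℕ} (hj : j + 1 < n) (C : Finset (Fin n))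
    (h1 : (⟨j, Nat.lt_of_succ_lt hj⟩ : Fin n) ∉ C) (h2 : (⟨j + 1, hj⟩ : Fin n) ∈ C) :
    Ti n C = Tt n j * Ti n (sCol n j C) := by
  have hs := colPerm_sCol hj C (by tauto)
  set u := colPerm n (sCol n j C) with hu
  have hCu : colPerm n C = sgen n j * u := by rw [hs, sgen_sgen]
  have hd : ¬ asc n j hj (colPerm n C) := by
    have := asc_down hj C h1 h2 (v := 1) (by rw [stab_iff]; simp)
    rwa [mul_one] at this
  have ha : asc n j hj u := by rw [hs, asc_sgen]; exact hd
  unfold Ti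
  rw [← hu, hCu, mul_inv_rev, sgen_inv, Tw_right hj (by rw [inv_inv]; exact ha),
    ring_inverse_mul (Tw_unit n _) (Tg_unit hj), tpow_mul, tpow_mul, mul_smul_comm, ← tH_inv_Tg hj,
    tH_eq, len_eq, len_eq, invs_asc hj u ha, pow_succ, mul_smul, smul_mul_assoc, smul_mul_assoc]
  simp

lemma Ti_neutral {n j p : ℕ} (hj : j + 1 < n) (C : Finset (Fin n)) (hp : p + 1 < n)
    (h1 : (colPerm n C)⁻¹ ⟨j, Nat.lt_of_succ_lt hj⟩ = ⟨p, Nat.lt_of_succ_lt hp⟩)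
    (h2 : (colPerm n C)⁻¹ ⟨j + 1, hj⟩ = ⟨p + 1, hp⟩) :
    Ti n C * Tg n p = Tg n j * Ti n C := by
  have hc := neutral_comm hj _ hp h1 h2
  set u := colPerm n C with hu
  have h1' : u ⟨p, Nat.lt_of_succ_lt hp⟩ = ⟨j, Nat.lt_of_succ_lt hj⟩ := by rw [← h1, perm_apply_inv]
  have h2' : u ⟨p + 1, hp⟩ = ⟨j + 1, hj⟩ := by rw [← h2, perm_apply_inv]
  have hc' : sgen n p * u⁻¹ = u⁻¹ * sgen n j := by
    rw [eq_inv_mul_iff_mul_eq, ← mul_assoc, ← hc, mul_assoc, mul_inv_cancel, mul_one]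
  have hT : Tg n p * Tw n u⁻¹ = Tw n u⁻¹ * Tg n j := by
    rw [← Tw_asc hp, ← Tw_right hj, hc']
    · unfold asc; rw [inv_inv, h1, h2, Fin.lt_def]; simp
    · unfold asc; rw [inv_inv, h1', h2', Fin.lt_def]; simp
  have hU := Tw_unit n u⁻¹
  unfold Ti
  rw [← hu, mul_assoc, tpow_mul, tpow_mul, mul_smul_comm]
  congr 1
  calc Ring.inverse (Tw n u⁻¹) * Tg n p
      = Ring.inverse (Tw n u⁻¹) * (Tg n p * Tw n u⁻¹) * Ring.inverse (Tw n u⁻¹) := by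
        rw [mul_assoc, mul_assoc, Ring.mul_inverse_cancel _ hU, mul_one]
    _ = Tg n j * Ring.inverse (Tw n u⁻¹) := by
        rw [hT, ← mul_assoc, Ring.inverse_mul_cancel _ hU, one_mul]

/-- `Φ_C(h)` -/
def Ph (n : ℕ) (C : Finset (Fin n)) (h : H n) : H n := Ti n C * coef n C h

lemma Ph_add (n : ℕ) (C : Finset (Fin n)) (h k : H n) : Ph n C (h + k) = Ph n C h + Ph n C k := by
  rw [Ph, coef_add, mul_add]; rfl

lemma Ph_smul (n : ℕ) (C : Finset (Fin n)) (a : HR) (h : H n) : Ph n C (a • h) = a • Ph n C h := by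
  rw [Ph, coef_smul, mul_smul_comm]; rfl

lemma Ph_zero (n : ℕ) (C : Finset (Fin n)) : Ph n C 0 = 0 := by
  have := Ph_smul n C 0 0
  simpa using this

lemma Ph_sum (n : ℕ) (C : Finset (Fin n)) {ι : Type*} (s : Finset ι) (f : ι → H n) :
    Ph n C (∑ i ∈ s, f i) = ∑ i ∈ s, Ph n C (f i) := by
  rw [Ph, coef_sum, Finset.mul_sum]; rfl

/-- `j ∈ C`, `j+1 ∉ C`. -/
def up (n j : ℕ) (hj : j + 1 < n) (C : Finset (Fin n)) : Prop :=
  (⟨j, Nat.lt_of_succ_lt hj⟩ : Fin n) ∈ C ∧ (⟨j + 1, hj⟩ : Fin n) ∉ C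

lemma Ph_Tg_up {n j : ℕ} (hj : j + 1 < n) (C : Finset (Fin n)) (h : H n) (hu : up n j hj C) :
    Ph n C (Tg n j * h) = Tg n j * Ph n (sCol n j C) h := by
  have hd := Ti_down hj (sCol n j C) (by rw [mem_sCol, sgen_j hj]; exact hu.2)
    (by rw [mem_sCol, sgen_j1 hj]; exact hu.1)
  rw [sCol_sCol] at hd
  unfold Ph
  rw [coef_up hj C h hu.1 hu.2, hd, ← mul_assoc, ← mul_assoc, Tg_Tt hj, tH_eq, mul_smul_comm,
    smul_mul_assoc, smul_mul_assoc, one_mul]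

lemma Ph_Tt_up {n j : ℕ} (hj : j + 1 < n) (C : Finset (Fin n)) (h : H n) (hu : up n j hj C) :
    Ph n C (Tt n j * h) = Tg n j * Ph n (sCol n j C) h + (1 - tt) • Ph n C h := by
  rw [Tt_mul, Ph_add, Ph_Tg_up hj C h hu, Ph_smul]

lemma Ph_Tt_nup {n j : ℕ} (hj : j + 1 < n) (C : Finset (Fin n)) (h : H n) (hu : ¬ up n j hj C) :
    Ph n C (Tt n j * h) = Tt n j * Ph n (sCol n j C) h := by
  by_cases hn : ((⟨j, Nat.lt_of_succ_lt hj⟩ : Fin n) ∈ C ↔ (⟨j + 1, hj⟩ : Fin n) ∈ C)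
  · obtain ⟨p, hp, h1, h2, hb⟩ := neutral_adj hj C hn
    have hc := neutral_comm hj _ hp h1 h2
    rw [sCol_neutral hj C hn, Tt_mul, Tt_mul, Ph_add, Ph_smul]
    congr 1
    unfold Ph
    rw [coef_neutral hj C h hp h1 h2 hb hc, ← mul_assoc, Ti_neutral hj C hp h1 h2, mul_assoc]
  · have hd : (⟨j, Nat.lt_of_succ_lt hj⟩ : Fin n) ∉ C ∧ (⟨j + 1, hj⟩ : Fin n) ∈ C := by
      unfold up at hu; tauto
    unfold Ph
    rw [Tt_mul, coef_add, coef_smul, coef_down hj C h hd.1 hd.2, Ti_down hj C hd.1 hd.2, ← mul_assoc]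
    congr 1
    module

lemma Ph_Tg_nup {n j : ℕ} (hj : j + 1 < n) (C : Finset (Fin n)) (h : H n) (hu : ¬ up n j hj C) :
    Ph n C (Tg n j * h) = Tt n j * Ph n (sCol n j C) h + (-(1 - tt)) • Ph n C h := by
  rw [← Ph_Tt_nup hj C h hu, Tt_mul, Ph_add, Ph_smul]
  module

lemma MM_ext {n : ℕ} {h k : H n} (hh : h ∈ MM n) (hk : k ∈ MM n) (he : ∀ w, ev n h w = ev n k w) :
    h = k := by
  rw [MM_expand hh, MM_expand hk]
  exact Finset.sum_congr rfl fun w _ => by rw [he]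

lemma Tt_one0 {n j : ℕ} (hj : j + 1 < n) : Tt n j * one0 n = one0 n := by
  apply MM_ext (Tt_mul_mem hj (one0_mem n)) (one0_mem n)
  intro w
  rw [Tt_mul, map_add, map_smul, Pi.add_apply, Pi.smul_apply, ev_T hj, ev_one0, ev_one0]
  split_ifs <;> simp

lemma Tt_Psi_neutral {n j : ℕ} (hj : j + 1 < n) : ∀ L : List (Finset (Fin n)),
    (∀ C ∈ L, ((⟨j, Nat.lt_of_succ_lt hj⟩ : Fin n) ∈ C ↔ (⟨j + 1, hj⟩ : Fin n) ∈ C)) →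
    Tt n j * Psi n L = Psi n L := by
  intro L
  induction L with
  | nil => intro _; exact Tt_one0 hj
  | cons C S ih =>
    intro h
    have hS := ih fun D hD => h D (List.mem_cons_of_mem _ hD)
    have hC := h C List.mem_cons_self
    have := Ph_Tt_nup hj C (Psi n S) (by unfold up; tauto)
    rw [sCol_neutral hj C hC, hS] at this
    rw [Psi_cons]
    exact this.symm

/-- the leading operator -/
def XX (n j : ℕ) (hj : j + 1 < n) (C : Finset (Fin n)) : H n := if up n j hj C then Tg n j else Tt n j

/-- the scalar coefficient -/
def cc (n j : ℕ) (D C : Finset (Fin n)) : HR :=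
  if sigmaSign n j D * sigmaSign n j C = -1 then (sigmaSign n j D : HR) * (1 - tt) else 0

lemma sigma_up {n j : ℕ} (hj : j + 1 < n) {C : Finset (Fin n)} (h : up n j hj C) :
    sigmaSign n j C = -1 := by
  unfold sigmaSign; rw [dif_pos hj]; exact if_pos h

lemma sigma_nup {n j : ℕ} (hj : j + 1 < n) {C : Finset (Fin n)} (h : ¬ up n j hj C) :
    sigmaSign n j C = 1 := by
  unfold sigmaSign; rw [dif_pos hj]; exact if_neg h

lemma Ph_step {n j : ℕ} (hj : j + 1 < n) (D C : Finset (Fin n)) (h : H n) :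
    Ph n C (XX n j hj D * h) = XX n j hj C * Ph n (sCol n j C) h + cc n j D C • Ph n C h := by
  unfold XX cc
  by_cases hD : up n j hj D <;> by_cases hC : up n j hj C
  · rw [if_pos hD, if_pos hC, sigma_up hj hD, sigma_up hj hC, Ph_Tg_up hj C h hC]; norm_num
  · rw [if_pos hD, if_neg hC, sigma_up hj hD, sigma_nup hj hC, Ph_Tg_nup hj C h hC]; norm_num
  · rw [if_neg hD, if_pos hC, sigma_nup hj hD, sigma_up hj hC, Ph_Tt_up hj C h hC]; norm_num
  · rw [if_neg hD, if_neg hC, sigma_nup hj hD, sigma_nup hj hC, Ph_Tt_nup hj C h hC]; norm_num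

lemma OmTab_succ (n j r : ℕ) (Cc : ℕ → Finset (Fin n)) (μ : Fin n → ℤ) (m : ℕ) :
    OmTab n j (r + 1) Cc μ m
      = (if r < m then sCol n j (Cc r) else Cc r) :: OmTab n j r Cc μ m := by
  unfold OmTab
  rw [List.ofFn_succ_last]
  simp

lemma OmTab_ge (n j r : ℕ) (Cc : ℕ → Finset (Fin n)) (μ : Fin n → ℤ) (m : ℕ) (h : r ≤ m) :
    OmTab n j r Cc μ m = OmTab n j r Cc μ r := by
  unfold OmTab
  congr 3
  funext k
  rw [if_pos (by omega), if_pos k.2]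

lemma main_ind {n j : ℕ} (hj : j + 1 < n) (Cc : ℕ → Finset (Fin n)) (μ : Fin n → ℤ)
    (h0 : ¬ up n j hj (Cc 0)) (hb : Tt n j * Psi n (hwTableau n μ) = Psi n (hwTableau n μ)) (r : ℕ) :
    Psi n (OmTab n j (r + 1) Cc μ 0) = XX n j hj (Cc r) * Psi n (OmTab n j (r + 1) Cc μ (r + 1))
      + ∑ k ∈ Finset.range r, cc n j (Cc k) (Cc (k + 1)) • Psi n (OmTab n j (r + 1) Cc μ (k + 1)) := by
  induction r with
  | zero =>
    have e : ∀ m, OmTab n j 0 Cc μ m = hwTableau n μ := fun m => by simp [OmTab]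
    rw [OmTab_succ, OmTab_succ, e, e, Psi_cons, Psi_cons, if_neg (by omega), if_pos (by omega)]
    have := Ph_Tt_nup hj (Cc 0) (Psi n (hwTableau n μ)) h0
    rw [hb] at this
    unfold XX
    rw [if_neg h0, Finset.range_zero, Finset.sum_empty, add_zero]
    exact this
  | succ r ih =>
    rw [OmTab_succ n j (r + 1) Cc μ 0, if_neg (by omega), Psi_cons]
    change Ph n _ _ = _
    rw [ih, Ph_add, Ph_sum, Ph_step hj, Finset.sum_range_succ]
    have e1 : Ph n (sCol n j (Cc (r + 1))) (Psi n (OmTab n j (r + 1) Cc μ (r + 1)))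
        = Psi n (OmTab n j (r + 1 + 1) Cc μ (r + 1 + 1)) := by
      rw [OmTab_succ n j (r + 1) Cc μ (r + 1 + 1), if_pos (by omega), OmTab_ge n j (r + 1) Cc μ (r + 1 + 1) (by omega),
        Psi_cons]
      rfl
    have e2 : ∀ k ≤ r, Ph n (Cc (r + 1)) (Psi n (OmTab n j (r + 1) Cc μ (k + 1)))
        = Psi n (OmTab n j (r + 1 + 1) Cc μ (k + 1)) := by
      intro k hk
      rw [OmTab_succ n j (r + 1) Cc μ (k + 1), if_neg (by omega), Psi_cons]
      rfl
    rw [e1, e2 r le_rfl, Finset.sum_congr rfl (fun k hk => by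
      rw [Ph_smul, e2 k (Finset.mem_range.1 hk).le])]
    rw [add_assoc]
    congr 1
    exact add_comm _ _

lemma nth_eq {n : ℕ} (C : Finset (Fin n)) {m : ℕ} (h : C.card = m) {k : ℕ} (hk : k < m) :
    nth n C k = (C.orderEmbOfFin h ⟨k, hk⟩ : Fin n) := by
  unfold nth
  rw [Finset.orderEmbOfFin_apply]
  rw [List.getD_eq_getElem _ _ (by simp [h, hk])]
  simp

lemma emb_ge {n m : ℕ} (f : Fin m ↪o Fin n) : ∀ (k : ℕ) (hk : k < m), k ≤ (f ⟨k, hk⟩ : ℕ) := by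
  intro k
  induction k with
  | zero => intro _; exact Nat.zero_le _
  | succ k ih =>
    intro hk
    have h1 := ih (by omega)
    have h2 : f ⟨k, by omega⟩ < f ⟨k + 1, hk⟩ := by
      rw [f.lt_iff_lt, Fin.lt_def]; simp
    rw [Fin.lt_def] at h2
    omega

lemma nth_hwCol {n m k : ℕ} (hm : m ≤ n) (hk : k < m) : nth n (hwCol n m) k = k := by
  rw [nth_eq (hwCol n m) (hwCol_card hm) hk]
  have := Finset.orderEmbOfFin_unique (hwCol_card hm) (f := Fin.castLE hm)
    (fun x => by rw [mem_hwCol]; exact x.2) (Fin.strictMono_castLE hm)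
  rw [← this]; rfl

lemma base_le {n j : ℕ} (hj : j + 1 < n) (C : Finset (Fin n)) (m : ℕ) (hm : m ≤ C.card)
    (hss : pairSS n C (hwCol n m)) (h1 : (⟨j, Nat.lt_of_succ_lt hj⟩ : Fin n) ∉ C) : m ≤ j := by
  by_contra hc
  have hmn : m ≤ n := hm.trans (col_card_le n C)
  have h := hss j (by rw [hwCol_card hmn]; omega)
  have hjc : j < C.card := by omega
  rw [nth_hwCol hmn (by omega), nth_eq C rfl hjc] at h
  have h2 := emb_ge (C.orderEmbOfFin rfl) j hjc
  have h3 := Finset.orderEmbOfFin_mem C rfl ⟨j, hjc⟩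
  have e : C.orderEmbOfFin rfl ⟨j, hjc⟩ = ⟨j, Nat.lt_of_succ_lt hj⟩ := Fin.ext (le_antisymm h h2)
  rw [e] at h3
  exact h1 h3

lemma hw_base {n j : ℕ} (hj : j + 1 < n) (r : ℕ) (hr : 1 ≤ r) (Cc : ℕ → Finset (Fin n)) (μ : Fin n → ℤ)
    (hshape : shapeColLen n μ 0 ≤ (Cc 0).card)
    (hss : isSSYT n (OmTab n j r Cc μ 0))
    (hj1 : (⟨j, Nat.lt_of_succ_lt hj⟩ : Fin n) ∉ Cc 0) :
    Tt n j * Psi n (hwTableau n μ) = Psi n (hwTableau n μ) := by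
  apply Tt_Psi_neutral hj
  intro C hC
  unfold hwTableau at hC
  rw [List.mem_ofFn] at hC
  obtain ⟨k, rfl⟩ := hC
  have hk := k.2
  have hle : shapeColLen n μ k ≤ shapeColLen n μ 0 := by
    apply Finset.card_le_card
    intro i
    simp only [Finset.mem_filter, Finset.mem_univ, true_and]
    intro h
    have : (0 : ℤ) ≤ ((k : ℕ) : ℤ) := by positivity
    push_cast
    omega
  have hm : shapeColLen n μ 0 ≤ j := by
    apply base_le hj (Cc 0) _ hshape _ hj1
    unfold isSSYT OmTab at hss
    have h := (List.isChain_append.1 hss).2.2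
    apply h
    · obtain ⟨r, rfl⟩ : ∃ r', r = r' + 1 := ⟨r - 1, by omega⟩
      rw [List.ofFn_succ]
      simp
    · unfold hwTableau
      obtain ⟨N, hN⟩ : ∃ N, numCols n μ = N + 1 := ⟨numCols n μ - 1, by omega⟩
      rw [List.head?_eq_getElem?]
      simp [hN]
  rw [mem_hwCol, mem_hwCol]
  constructor <;> intro h <;> simp only at h <;> omega

lemma sum_conv {n j : ℕ} (Cc : ℕ → Finset (Fin n)) (r : ℕ) (f : ℕ → H n) :
    ∑ k ∈ (Finset.range r).filter
              (fun k => sigmaSign n j (Cc k) * sigmaSign n j (Cc (k + 1)) = -1),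
              sigmaSign n j (Cc k) • ((1 - tH n) * f k)
      = ∑ k ∈ Finset.range r, cc n j (Cc k) (Cc (k + 1)) • f k := by
  rw [Finset.sum_filter]
  apply Finset.sum_congr rfl
  intro k _
  unfold cc
  split_ifs
  · rw [one_sub_tH_mul, mul_smul]
    exact (Int.cast_smul_eq_zsmul HR (sigmaSign n j (Cc k)) ((1 - tt) • f k)).symm
  · rw [zero_smul]


/-- the `r`-column recursion (Hecke algebra lift of Klostermann's recursions)
for `Ψ_{T ⊗ T⁰_μ}`, where `T = C_r ⊗ … ⊗ C₁`, `j ∉ C₁`, `j+1 ∈ C₁`. -/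
theorem stmt17 (n : ℕ) (hn : 1 ≤ n) (j : ℕ) (hj : j + 1 < n)
    (r : ℕ) (hr : 1 ≤ r) (Cc : ℕ → Finset (Fin n))
    (hmono : ∀ k k' : ℕ, k ≤ k' → k' < r → (Cc k).card ≤ (Cc k').card)
    (hpos : 1 ≤ (Cc 0).card) (hcn : (Cc (r - 1)).card ≤ n)
    (μ : Fin n → ℤ) (hdom : Antitone μ) (hnonneg : ∀ i, 0 ≤ μ i)
    (hshape : shapeColLen n μ 0 ≤ (Cc 0).card)
    (hss : isSSYT n (OmTab n j r Cc μ 0))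
    (hj1 : (⟨j, by omega⟩ : Fin n) ∉ Cc 0) (hj2 : (⟨j + 1, hj⟩ : Fin n) ∈ Cc 0) :
    (((⟨j, by omega⟩ : Fin n) ∈ Cc (r - 1) ∧ (⟨j + 1, hj⟩ : Fin n) ∉ Cc (r - 1)) →
      Psi n (OmTab n j r Cc μ 0)
        = Tg n j * Psi n (OmTab n j r Cc μ r)
          + ∑ k ∈ (Finset.range (r - 1)).filter
              (fun k => sigmaSign n j (Cc k) * sigmaSign n j (Cc (k + 1)) = -1),
              sigmaSign n j (Cc k) • ((1 - tH n) * Psi n (OmTab n j r Cc μ (k + 1))))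
    ∧ (¬ ((⟨j, by omega⟩ : Fin n) ∈ Cc (r - 1) ∧ (⟨j + 1, hj⟩ : Fin n) ∉ Cc (r - 1)) →
      Psi n (OmTab n j r Cc μ 0)
        = tH n * Ring.inverse (Tg n j) * Psi n (OmTab n j r Cc μ r)
          + ∑ k ∈ (Finset.range (r - 1)).filter
              (fun k => sigmaSign n j (Cc k) * sigmaSign n j (Cc (k + 1)) = -1),
              sigmaSign n j (Cc k) • ((1 - tH n) * Psi n (OmTab n j r Cc μ (k + 1)))) := by
  have h0 : ¬ up n j hj (Cc 0) := fun h => hj1 h.1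
  have hb := hw_base hj r hr Cc μ hshape hss hj1
  obtain ⟨r, rfl⟩ : ∃ r', r = r' + 1 := ⟨r - 1, by omega⟩
  have hm := main_ind hj Cc μ h0 hb r
  simp only [Nat.add_sub_cancel]
  rw [sum_conv Cc r (fun k => Psi n (OmTab n j (r + 1) Cc μ (k + 1))), tH_inv_Tg hj]
  constructor
  · intro hu
    rw [hm]
    unfold XX
    rw [if_pos (show up n j hj (Cc r) from hu)]
  · intro hu
    rw [hm]
    unfold XX
    rw [if_neg (show ¬ up n j hj (Cc r) from hu)]

end HLHecke
end
end

section
/- Let n ≥ 1 and let ψ be Macdonald's tableau statistic. (1) If T = C_r ⊗ … ⊗ C₁ is a filling by columns C_i ∈ B(ϖ_{ℓ_i}) with 1 ≤ ℓ₁ ≤ … ≤ ℓ_r ≤ n, then ψ_T = Π_{j=1}^{r−1} ψ_{C_{j+1}⊗C_j}. (2) For 1 ≤ a ≤ b ≤ n and columns F ∈ B(ϖ_b), E ∈ B(ϖ_a): (a) if F⊗E is not semistandard then ψ_{F⊗E} = 0; (b) if E = (1,…,a) and F⊗E is semistandard then ψ_{F⊗E} = 1; (c) if F⊗E is semistandard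 and j ∉ E, j+1 ∈ E, then ψ_{F⊗E} = t ψ_{s_jF⊗s_jE} + (1−t) ψ_{F⊗s_jE} when j ∈ F and j+1 ∉ F, and ψ_{F⊗E} = ψ_{s_jF⊗s_jE} otherwise. -/
set_option maxHeartbeats 1000000

attribute [local instance] Classical.propDecidable

noncomputable section

namespace HLHecke


def cnt (n : ℕ) (C : Finset (Fin n)) (i : ℕ) : ℕ := (C.filter fun x : Fin n => (x : ℕ) < i).card

def fac (n : ℕ) (F E : Finset (Fin n)) (i : ℕ) : HR :=
  if cnt n F (i + 1) = cnt n F i ∧ cnt n E (i + 1) = cnt n E i + 1 then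
    1 - tt ^ (cnt n F i - cnt n E i) else 1

lemma list_filter_lt {n : ℕ} (i : ℕ) (l : List (Fin n)) (hl : l.Pairwise (· < ·)) (k : ℕ)
    (hk : k < l.length) :
    ((l[k] : ℕ) < i ↔ k < (l.filter fun x : Fin n => decide ((x : ℕ) < i)).length) := by
  induction l generalizing k with
  | nil => simp at hk
  | cons a l ih =>
    rw [List.pairwise_cons] at hl
    obtain ⟨h1, h2⟩ := hl
    have hge : ¬ (a : ℕ) < i → (l.filter fun x : Fin n => decide ((x : ℕ) < i)) = [] := by
      intro ha
      rw [List.filter_eq_nil_iff]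
      intro b hb
      have := h1 b hb
      simp only [decide_eq_true_eq]
      have : (a : ℕ) < b := this
      omega
    by_cases ha : (a : ℕ) < i
    · cases k with
      | zero => simp [List.filter_cons, ha]
      | succ k =>
        have := ih h2 k (by simpa using hk)
        simp [List.filter_cons, ha, this]
    · rw [List.filter_cons_of_neg (by simpa using ha), hge ha]
      cases k with
      | zero => simpa using ha
      | succ k =>
        have := h1 (l[k]'(by simpa using hk)) (List.getElem_mem _)
        have : (a : ℕ) < (l[k]'(by simpa using hk) : Fin n) := this
        simp only [List.getElem_cons_succ, List.length_nil]
        omega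

lemma nth_lt {n : ℕ} (C : Finset (Fin n)) (i k : ℕ) (hk : k < C.card) :
    nth n C k < i ↔ k < cnt n C i := by
  have hk' : k < (C.sort (· ≤ ·)).length := by simpa using hk
  have h := list_filter_lt i (C.sort (· ≤ ·)) (Finset.sortedLT_sort C).pairwise k hk'
  have h1 : nth n C k = ((C.sort (· ≤ ·))[k] : ℕ) := by
    unfold nth
    rw [List.getD_eq_getElem _ _ (by simpa using hk)]
    simp
  have h2 : cnt n C i = ((C.sort (· ≤ ·)).filter fun x : Fin n => decide ((x : ℕ) < i)).length := by
    unfold cnt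
    rw [← List.toFinset_card_of_nodup ((Finset.sort_nodup C _).filter _)]
    congr 1
    ext x
    simp
  rw [h1, h2, h]

lemma cnt_le {n : ℕ} (C : Finset (Fin n)) (i : ℕ) : cnt n C i ≤ C.card :=
  Finset.card_filter_le _ _

lemma pairSS_iff {n : ℕ} (F E : Finset (Fin n)) (h : E.card ≤ F.card) :
    pairSS n F E ↔ ∀ i, cnt n E i ≤ cnt n F i := by
  constructor
  · intro hs i
    by_contra hc
    push Not at hc
    have hE := cnt_le E i
    have h1 := (nth_lt E i (cnt n F i) (by omega)).2 hc
    have h2 := hs (cnt n F i) (by omega)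
    have h3 := (nth_lt F i (cnt n F i) (by omega)).1 (by omega)
    omega
  · intro hs k hk
    by_contra hc
    push Not at hc
    have h1 := (nth_lt E _ k hk).1 hc
    have h2 := hs (nth n F k)
    have h3 := (nth_lt F (nth n F k) k (by omega)).2 (by omega)
    omega

lemma cnt_succ {n : ℕ} (C : Finset (Fin n)) (i : ℕ) (hi : i < n) :
    cnt n C (i + 1) = cnt n C i + if (⟨i, hi⟩ : Fin n) ∈ C then 1 else 0 := by
  unfold cnt
  by_cases h : (⟨i, hi⟩ : Fin n) ∈ C
  · have : (C.filter fun x : Fin n => (x : ℕ) < i + 1)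
        = insert ⟨i, hi⟩ (C.filter fun x : Fin n => (x : ℕ) < i) := by
      ext x
      simp only [Finset.mem_filter, Finset.mem_insert, Fin.ext_iff]
      constructor
      · rintro ⟨hx, hlt⟩
        by_cases hxi : (x : ℕ) = i
        · exact Or.inl hxi
        · exact Or.inr ⟨hx, by omega⟩
      · rintro (hx | ⟨hx, hlt⟩)
        · have : x = ⟨i, hi⟩ := Fin.ext hx
          subst this
          exact ⟨h, by simp⟩
        · exact ⟨hx, by omega⟩
    rw [this, Finset.card_insert_of_notMem (by simp), if_pos h]
  · rw [if_neg h, Nat.add_zero]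
    congr 1
    ext x
    simp only [Finset.mem_filter]
    constructor
    · rintro ⟨hx, hlt⟩
      refine ⟨hx, ?_⟩
      have : (x : ℕ) ≠ i := by
        intro hxi
        have : x = ⟨i, hi⟩ := Fin.ext hxi
        exact h (this ▸ hx)
      omega
    · rintro ⟨hx, hlt⟩
      exact ⟨hx, by omega⟩

lemma cnt_zero {n : ℕ} (C : Finset (Fin n)) : cnt n C 0 = 0 := by simp [cnt]

lemma cnt_sCol {n : ℕ} (j : ℕ) (hj : j + 1 < n) (C : Finset (Fin n)) (i : ℕ) (hi : i ≠ j + 1) :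
    cnt n (sCol n j C) i = cnt n C i := by
  unfold cnt sCol
  rw [Finset.filter_image, Finset.card_image_of_injective _ (sgen n j).injective]
  congr 1
  apply Finset.filter_congr
  intro x _
  unfold sgen
  rw [dif_pos hj, Equiv.swap_apply_def]
  split_ifs with h1 h2
  · subst h1; simp only; omega
  · subst h2; simp only; omega
  · rfl

lemma mem_sCol_left {n : ℕ} (j : ℕ) (hj : j + 1 < n) (C : Finset (Fin n)) :
    (⟨j, Nat.lt_of_succ_lt hj⟩ : Fin n) ∈ sCol n j C ↔ (⟨j + 1, hj⟩ : Fin n) ∈ C := by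
  unfold sCol sgen
  rw [dif_pos hj]
  constructor
  · intro h
    obtain ⟨x, hx, hxe⟩ := Finset.mem_image.1 h
    rw [Equiv.swap_apply_eq_iff, Equiv.swap_apply_left] at hxe
    exact hxe ▸ hx
  · intro h
    exact Finset.mem_image.2 ⟨_, h, Equiv.swap_apply_right _ _⟩

lemma card_sCol {n : ℕ} (j : ℕ) (C : Finset (Fin n)) : (sCol n j C).card = C.card :=
  Finset.card_image_of_injective _ (sgen n j).injective

lemma colCount_eq {n : ℕ} (L : List (Finset (Fin n))) (i p : ℕ) :
    colCount n L i p = cnt n (L.getD p ∅) i := by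
  unfold colCount cnt
  generalize L.getD p ∅ = C
  first
  | rfl
  | (symm
     rw [← Finset.card_image_of_injective _ Fin.val_injective]
     congr 1
     ext x
     simp [Fin.exists_iff]
     try aesop)

lemma strip_eq {n : ℕ} (L : List (Finset (Fin n))) (i : ℕ) (hL : L ≠ []) :
    stripFactor n L i = ∏ p ∈ Finset.range (L.length - 1), fac n (L.getD p ∅) (L.getD (p + 1) ∅) i := by
  have hlen : L.length = (L.length - 1) + 1 := by
    have := List.length_pos_iff.2 hL
    omega
  unfold stripFactor
  rw [hlen, Finset.prod_range_succ, if_neg, mul_one]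
  · simp only [colCount_eq]
    rfl
  · rintro ⟨-, h⟩
    rw [colCount_eq, colCount_eq] at h
    unfold cnt at h
    rw [List.getD_eq_default _ _ (by omega)] at h
    simp at h

lemma macPsi_pair {n : ℕ} (F E : Finset (Fin n)) :
    macPsi n [F, E] = ∏ i ∈ Finset.Ico 1 n, fac n F E i := by
  unfold macPsi
  apply Finset.prod_congr rfl
  intro i _
  rw [strip_eq _ _ (by simp)]
  simp

lemma isSSYT_pair {n : ℕ} (F E : Finset (Fin n)) : isSSYT n [F, E] ↔ pairSS n F E := by
  unfold isSSYT
  simp [List.Chain']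

lemma psi_eq {n : ℕ} (hn : 1 ≤ n) (F E : Finset (Fin n)) (h : E.card ≤ F.card) :
    psiT n [F, E] = ∏ i ∈ Finset.range n, fac n F E i := by
  unfold psiT
  rw [isSSYT_pair]
  split_ifs with hs
  · rw [macPsi_pair, Finset.range_eq_Ico, Finset.prod_eq_prod_Ico_succ_bot (show 0 < n by omega)]
    rw [pairSS_iff F E h] at hs
    have h1 := hs 1
    have : fac n F E 0 = 1 := by
      unfold fac
      rw [if_neg]
      rw [cnt_zero, cnt_zero]
      simp only [Nat.zero_add]
      omega
    rw [this, one_mul]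
  · rw [pairSS_iff F E h] at hs
    push Not at hs
    have hm := Nat.find_spec hs
    have hmin : ∀ m < Nat.find hs, ¬ _ := fun m hm => Nat.find_min hs hm
    generalize Nat.find hs = m at hm hmin
    cases m with
    | zero => simp [cnt_zero] at hm
    | succ m =>
      have h0 := hmin m (by omega)
      by_cases hmn : m < n
      · symm
        apply Finset.prod_eq_zero (Finset.mem_range.2 hmn)
        have h1 := cnt_succ F m hmn
        have h2 := cnt_succ E m hmn
        unfold fac
        have h3 : cnt n F m - cnt n E m = 0 := by split_ifs at h1 h2 <;> omega
        rw [if_pos (by split_ifs at h1 h2 <;> omega), h3]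
        simp
      · exfalso
        have hall : ∀ C : Finset (Fin n), ∀ i, n ≤ i → cnt n C i = C.card := by
          intro C i hi
          unfold cnt
          rw [Finset.filter_true_of_mem]
          intro x _
          omega
        rw [hall F _ (by omega), hall E _ (by omega)] at hm
        omega

lemma prod_split {n j : ℕ} (hj : j + 1 < n) (g : ℕ → HR) :
    ∏ i ∈ Finset.range n, g i
      = g j * g (j + 1) * ∏ i ∈ ((Finset.range n).erase j).erase (j + 1), g i := by
  rw [mul_assoc, Finset.mul_prod_erase _ _ (by simp; omega), Finset.mul_prod_erase _ _ (by simp; omega)]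

lemma psiT_fact {n : ℕ} (L : List (Finset (Fin n))) (hL : L ≠ []) :
    psiT n L = ∏ p ∈ Finset.range (L.length - 1), psiT n [L.getD p ∅, L.getD (p + 1) ∅] := by
  have hch : isSSYT n L ↔ ∀ p < L.length - 1, pairSS n (L.getD p ∅) (L.getD (p + 1) ∅) := by
    unfold isSSYT
    rw [List.Chain', List.isChain_iff_getElem]
    constructor
    · intro h p hp
      have := h p (by omega)
      rwa [List.getD_eq_getElem _ _ (by omega), List.getD_eq_getElem _ _ (by omega)]
    · intro h p hp
      have := h p (by omega)
      rwa [List.getD_eq_getElem _ _ (by omega), List.getD_eq_getElem _ _ (by omega)] at this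
  by_cases hs : isSSYT n L
  · have h1 : psiT n L = macPsi n L := if_pos hs
    rw [h1]
    unfold macPsi
    rw [Finset.prod_congr rfl (fun i _ => strip_eq L i hL), Finset.prod_comm]
    apply Finset.prod_congr rfl
    intro p hp
    unfold psiT
    rw [if_pos ((isSSYT_pair _ _).2 (hch.1 hs p (Finset.mem_range.1 hp))), macPsi_pair]
  · have h1 : psiT n L = 0 := if_neg hs
    rw [h1]
    rw [hch] at hs
    push Not at hs
    obtain ⟨p, hp, hps⟩ := hs
    symm
    apply Finset.prod_eq_zero (Finset.mem_range.2 hp)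
    unfold psiT
    rw [if_neg (by rwa [isSSYT_pair])]

/-- Macdonald's `ψ` factors over pairs of adjacent columns, and for two
columns it satisfies Klostermann's recursions. -/
theorem stmt18 (n : ℕ) (hn : 1 ≤ n) :
    (∀ L : List (Finset (Fin n)), L ≠ [] →
      (L.Chain' fun A B => B.card ≤ A.card) → (∀ C ∈ L, 1 ≤ C.card) →
      psiT n L = ∏ p ∈ Finset.range (L.length - 1), psiT n [L.getD p ∅, L.getD (p + 1) ∅])
    ∧ (∀ a b : ℕ, 1 ≤ a → a ≤ b → b ≤ n →
      ∀ E F : Finset (Fin n), E.card = a → F.card = b →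
        ((¬ pairSS n F E → psiT n [F, E] = 0)
          ∧ (E = hwCol n a → pairSS n F E → psiT n [F, E] = 1)
          ∧ (∀ j : ℕ, ∀ hj : j + 1 < n, pairSS n F E →
              (⟨j, by omega⟩ : Fin n) ∉ E → (⟨j + 1, hj⟩ : Fin n) ∈ E →
              ((((⟨j, by omega⟩ : Fin n) ∈ F ∧ (⟨j + 1, hj⟩ : Fin n) ∉ F) →
                  psiT n [F, E]
                    = tt * psiT n [sCol n j F, sCol n j E]
                        + (1 - tt) * psiT n [F, sCol n j E])
                ∧ (¬ ((⟨j, by omega⟩ : Fin n) ∈ F ∧ (⟨j + 1, hj⟩ : Fin n) ∉ F) →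
                  psiT n [F, E] = psiT n [sCol n j F, sCol n j E]))))) := by
  refine ⟨fun L hL _ _ => psiT_fact L hL, ?_⟩
  intro a b ha hab hb E F hE hF
  have hc : E.card ≤ F.card := by omega
  refine ⟨?_, ?_, ?_⟩
  · intro h
    unfold psiT
    rw [if_neg (by rwa [isSSYT_pair])]
  · intro hEa hs
    rw [psi_eq hn F E hc]
    rw [pairSS_iff F E hc] at hs
    apply Finset.prod_eq_one
    intro i hi
    have hin := Finset.mem_range.1 hi
    unfold fac
    rw [if_neg]
    rintro ⟨h1, h2⟩
    have hiE : (⟨i, hin⟩ : Fin n) ∈ E := by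
      by_contra hcon
      rw [cnt_succ E i hin, if_neg hcon] at h2
      omega
    rw [hEa] at hiE
    have hia : i < a := by simpa [hwCol] using hiE
    have hcE : ∀ k ≤ a, cnt n E k = k := by
      intro k hk
      induction k with
      | zero => exact cnt_zero E
      | succ k ih =>
        rw [cnt_succ E k (by omega), ih (by omega), if_pos]
        have hkm : ∀ hk' : k < n, (⟨k, hk'⟩ : Fin n) ∈ E := by
          intro hk'
          rw [hEa]
          simp [hwCol]
          omega
        exact hkm _
    have hle : ∀ k ≤ n, cnt n F k ≤ k := by
      intro k hk
      induction k with
      | zero => exact (cnt_zero F).le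
      | succ k ih =>
        have := ih (by omega)
        rw [cnt_succ F k (by omega)]
        split_ifs <;> omega
    have h3 := hs (i + 1)
    rw [hcE (i + 1) (by omega)] at h3
    have h4 := hle i (by omega)
    omega
  · intro j hj hs hjE hj1E
    rw [pairSS_iff F E hc] at hs
    have hm := hs j
    have e1 := cnt_succ E j (by omega)
    have e2 := cnt_succ E (j + 1) hj
    have e3 := cnt_succ (sCol n j E) j (by omega)
    have e4 := cnt_sCol j hj E j (by omega)
    have e5 := cnt_sCol j hj E (j + 1 + 1) (by omega)
    have f1 := cnt_succ F j (by omega)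
    have f2 := cnt_succ F (j + 1) hj
    have f3 := cnt_succ (sCol n j F) j (by omega)
    have f4 := cnt_sCol j hj F j (by omega)
    have f5 := cnt_sCol j hj F (j + 1 + 1) (by omega)
    simp only [mem_sCol_left j hj, if_pos hj1E, if_neg hjE] at e1 e2 e3 f3
    rw [psi_eq hn F E hc, psi_eq hn (sCol n j F) (sCol n j E) (by rw [card_sCol, card_sCol]; exact hc),
      psi_eq hn F (sCol n j E) (by rw [card_sCol]; exact hc)]
    rw [prod_split hj (fac n F E), prod_split hj (fac n (sCol n j F) (sCol n j E)),
      prod_split hj (fac n F (sCol n j E))]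
    have r1 : ∏ i ∈ ((Finset.range n).erase j).erase (j + 1), fac n (sCol n j F) (sCol n j E) i
        = ∏ i ∈ ((Finset.range n).erase j).erase (j + 1), fac n F E i := by
      apply Finset.prod_congr rfl
      intro i hi
      simp only [Finset.mem_erase] at hi
      unfold fac
      rw [cnt_sCol j hj F i (by omega), cnt_sCol j hj E i (by omega),
        cnt_sCol j hj F (i + 1) (by omega), cnt_sCol j hj E (i + 1) (by omega)]
    have r2 : ∏ i ∈ ((Finset.range n).erase j).erase (j + 1), fac n F (sCol n j E) i
        = ∏ i ∈ ((Finset.range n).erase j).erase (j + 1), fac n F E i := by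
      apply Finset.prod_congr rfl
      intro i hi
      simp only [Finset.mem_erase] at hi
      unfold fac
      rw [cnt_sCol j hj E i (by omega), cnt_sCol j hj E (i + 1) (by omega)]
    rw [r1, r2]
    have a1 : fac n F E j = 1 := by
      unfold fac
      rw [if_neg (by omega)]
    have a2 : fac n (sCol n j F) (sCol n j E) (j + 1) = 1 := by
      unfold fac
      rw [if_neg (by omega)]
    rw [a1, a2]
    constructor
    · rintro ⟨hjF, hj1F⟩
      rw [if_pos hjF] at f1
      rw [if_neg hj1F] at f2 f3
      have b1 : fac n F E (j + 1) = 1 - tt ^ (cnt n F j - cnt n E j + 1) := by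
        unfold fac
        rw [if_pos (by omega)]
        congr 2
        omega
      have b2 : fac n (sCol n j F) (sCol n j E) j = 1 - tt ^ (cnt n F j - cnt n E j) := by
        unfold fac
        rw [if_pos (by omega), e4, f4]
      have b3 : fac n F (sCol n j E) j = 1 := by
        unfold fac
        rw [if_neg (by omega)]
      have b4 : fac n F (sCol n j E) (j + 1) = 1 := by
        unfold fac
        rw [if_neg (by omega)]
      rw [b1, b2, b3, b4]
      ring
    · intro hF'
      by_cases hj1F : (⟨j + 1, hj⟩ : Fin n) ∈ F
      · rw [if_pos hj1F] at f2 f3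
        have b1 : fac n F E (j + 1) = 1 := by
          unfold fac
          rw [if_neg (by omega)]
        have b2 : fac n (sCol n j F) (sCol n j E) j = 1 := by
          unfold fac
          rw [if_neg (by omega)]
        rw [b1, b2]
      · have hjF : (⟨j, by omega⟩ : Fin n) ∉ F := fun h => hF' ⟨h, hj1F⟩
        rw [if_neg hjF] at f1
        rw [if_neg hj1F] at f2 f3
        have b1 : fac n F E (j + 1) = 1 - tt ^ (cnt n F j - cnt n E j) := by
          unfold fac
          rw [if_pos (by omega)]
          congr 2
          omega
        have b2 : fac n (sCol n j F) (sCol n j E) j = 1 - tt ^ (cnt n F j - cnt n E j) := by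
          unfold fac
          rw [if_pos (by omega), e4, f4]
        rw [b1, b2]
        ring

end HLHecke
end
end
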